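/- There exists a maximal cofinitary group G ≤ S∞ which, viewed as a set of functions ℕ → ℕ, is an Fσ subset of Baire space. -/

import Mathlib

/-- A set `s` in a topological space is Fσ if it is a countable union of closed sets. -/
def IsFsigma {X : Type*} [TopologicalSpace X] (s : Set X) : Prop :=
  ∃ f : ℕ → Set X, (∀ n, IsClosed (f n)) ∧ s = ⋃ n, f n

/-- A subgroup of `S∞ = Equiv.Perm ℕ` is cofinitary if every non-identity element has only
finitely many fixed points. -/
def IsCofinitary (G : Subgroup (Equiv.Perm ℕ)) : Prop :=
  ∀ g ∈ G, g ≠ 1 → {n : ℕ | g n = n}.Finite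

/-- A cofinitary group is maximal if it is not strictly contained in any cofinitary group. -/
def IsMaximalCofinitary (G : Subgroup (Equiv.Perm ℕ)) : Prop :=
  IsCofinitary G ∧ ∀ H : Subgroup (Equiv.Perm ℕ), IsCofinitary H → G ≤ H → G = H


namespace MCG
open Filter

abbrev Z := ℕ → ℕ
abbrev B := (ℕ × ℕ) ⊕ List ℕ
abbrev V := B × List (List ℕ)

noncomputable def cd : V ≃ ℕ := Denumerable.eqv V

def pre (f : Z) (m : ℕ) : List ℕ := (List.range m).map f

@[simp] lemma pre_length (f : Z) (m : ℕ) : (pre f m).length = m := by simp [pre]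

lemma pre_getElem? (f : Z) (m i : ℕ) : (pre f m)[i]? = if i < m then some (f i) else none := by
  unfold pre
  split_ifs with h
  · simp [h]
  · simp; omega

lemma pre_eq_iff {f g : Z} {m : ℕ} : pre f m = pre g m ↔ ∀ i < m, f i = g i := by
  simp [pre]

lemma pre_inj {f g : Z} {m m' : ℕ} (h : pre f m = pre g m') : m = m' ∧ ∀ i < m, f i = g i := by
  have h1 : m = m' := by simpa using congrArg List.length h
  subst h1
  exact ⟨rfl, pre_eq_iff.1 h⟩

lemma pre_take (f : Z) {k m : ℕ} (h : k ≤ m) : (pre f m).take k = pre f k := by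
  simp [pre, ← List.map_take, List.take_range, h]

def qof : B → ℕ
  | .inl x => x.1
  | .inr _ => 0

noncomputable def mm (b : B) : List (List ℕ) → ℕ
  | [] => cd (b, []) + 2 + qof b
  | s :: r => mm b r + cd (b, s :: r) + 1

lemma mm_ge_two (b : B) (r) : 2 ≤ mm b r := by
  induction r with
  | nil => simp [mm]; omega
  | cons s r ih => simp [mm]; omega

lemma mm_ge_cd (b : B) (r) : cd (b, r) ≤ mm b r := by
  cases r with
  | nil => simp [mm]; omega
  | cons s r => simp [mm]; omega

lemma mm_ge_q (b : B) (r) : qof b ≤ mm b r := by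
  induction r with
  | nil => simp [mm]
  | cons s r ih => simp [mm]; omega

lemma mm_fin (N : ℕ) : {u : V | mm u.1 u.2 ≤ N}.Finite := by
  apply Set.Finite.subset ((Set.finite_Iic N).preimage (cd.injective.injOn))
  intro u hu
  exact le_trans (mm_ge_cd u.1 u.2) hu

def dnx (x : Z) (b : B) : List (List ℕ) → Prop
  | [] => False
  | s :: r => s = pre x (mm b r) ∧ ¬ dnx x b r

def dnl (s0 : List ℕ) (b : B) : List (List ℕ) → Prop
  | [] => False
  | s :: r => s = s0.take (mm b r) ∧ ¬ dnl s0 b r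

lemma dnx_iff_dnl (x : Z) (b : B) (M : ℕ) (r) (h : mm b r ≤ M) :
    dnx x b r ↔ dnl (pre x M) b r := by
  induction r with
  | nil => simp [dnx, dnl]
  | cons s r ih =>
    have h' : mm b r ≤ M := by simp [mm] at h; omega
    simp [dnx, dnl, ih h', pre_take x h']

def Prp (b : B) : List (List ℕ) → Prop
  | [] => True
  | s :: r => Prp b r ∧ s.length = mm b r ∧ ¬ dnl s b r

def cmp (s s' : List ℕ) : Prop := s <+: s' ∨ s' <+: s

lemma cmp_refl (s) : cmp s s := Or.inl (List.prefix_refl s)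
lemma cmp_symm {s s'} (h : cmp s s') : cmp s' s := Or.symm h

lemma cmp_pre (f : Z) (m m' : ℕ) : cmp (pre f m) (pre f m') := by
  rcases le_total m m' with h | h
  · left; rw [← pre_take f h]; exact List.take_prefix _ _
  · right; rw [← pre_take f h]; exact List.take_prefix _ _

def Coh (v v' : V) : Prop := ∃ s s', v.1 = .inr s ∧ v'.1 = .inr s' ∧ cmp s s' ∧
  List.Forall₂ cmp v.2 v'.2 ∧ Prp v.1 v.2 ∧ Prp v'.1 v'.2

lemma Coh.symm {v v'} (h : Coh v v') : Coh v' v := by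
  obtain ⟨s, s', h1, h2, h3, h4, h5, h6⟩ := h
  exact ⟨s', s, h2, h1, cmp_symm h3, (h4.imp fun _ _ h => cmp_symm h).flip, h6, h5⟩

lemma Coh.self {v v'} (h : Coh v v') : Coh v v := by
  obtain ⟨s, s', h1, h2, h3, h4, h5, h6⟩ := h
  exact ⟨s, s, h1, h1, cmp_refl _, by simp [List.forall₂_same, cmp_refl], h5, h5⟩

def nb (v v' : V) : Prop := ∃ q p p', v.1 = .inl (q, p) ∧ v'.1 = .inl (q, p') ∧ p ≤ q ∧ p' ≤ q ∧ p ≠ p'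

lemma nb.symm {v v'} (h : nb v v') : nb v' v := by
  obtain ⟨q, p, p', h1, h2, h3, h4, h5⟩ := h
  exact ⟨q, p', p, h2, h1, h4, h3, h5.symm⟩

def conf (v v' : V) : Prop := Coh v v' ∨ nb v v'

lemma conf.symm {v v'} (h : conf v v') : conf v' v := h.imp Coh.symm nb.symm

/-- root vertex -/
def R (f : Z) (m : ℕ) : V := (.inr (pre f m), [])

lemma R_inj {f g : Z} {m m'} (h : R f m = R g m') : m = m' ∧ ∀ i < m, f i = g i := by
  simp [R] at h
  exact pre_inj h

noncomputable def val (f : Z) (m : ℕ) : V := cd.symm (f (cd (R f m)))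

lemma val_inj {f : Z} (hf : Function.Injective f) {m m'} (h : val f m = val f m') : m = m' := by
  have := cd.injective (hf (cd.symm.injective h))
  exact (R_inj this).1

def lblV (v : V) : List ℕ := match v.1 with
  | .inl _ => []
  | .inr s => s

noncomputable def lbl (f : Z) (m : ℕ) : List ℕ := lblV (val f m)

/-! Ramsey selection -/

noncomputable def SS (f : Z) : ℕ → Set ℕ
  | 0 => Set.univ
  | i + 1 => {j | j ∈ SS f i ∧ sInf (SS f i) < j ∧
      ({k | k ∈ SS f i ∧ sInf (SS f i) < k ∧ ¬ conf (val f (sInf (SS f i))) (val f k)}.Infinite ↔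
        ¬ conf (val f (sInf (SS f i))) (val f j))}

noncomputable def dd (f : Z) (i : ℕ) : ℕ := sInf (SS f i)

def inf0 (f : Z) (i : ℕ) : Prop :=
  {k | k ∈ SS f i ∧ dd f i < k ∧ ¬ conf (val f (dd f i)) (val f k)}.Infinite

lemma SS_succ (f : Z) (i : ℕ) : SS f (i+1) = {j | j ∈ SS f i ∧ dd f i < j ∧
    (inf0 f i ↔ ¬ conf (val f (dd f i)) (val f j))} := rfl

lemma SS_inf (f : Z) (i : ℕ) : (SS f i).Infinite := by
  induction i with
  | zero => exact Set.infinite_univ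
  | succ i ih =>
    rw [SS_succ]
    by_cases h : inf0 f i
    · simp only [h, true_iff]; exact h
    · simp only [h, false_iff, not_not]
      unfold inf0 at h
      rw [Set.not_infinite] at h
      intro hfin
      apply ih
      apply Set.Finite.subset ((h.union hfin).union (Set.finite_Iic (dd f i)))
      intro k hk
      by_cases h1 : dd f i < k
      · left
        by_cases h2 : conf (val f (dd f i)) (val f k)
        · right; exact ⟨hk, h1, h2⟩
        · left; exact ⟨hk, h1, h2⟩
      · right; simpa using h1

lemma dd_mem (f : Z) (i : ℕ) : dd f i ∈ SS f i := Nat.sInf_mem (SS_inf f i).nonempty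

lemma SS_anti (f : Z) {i j : ℕ} (h : i ≤ j) : SS f j ⊆ SS f i := by
  induction j, h using Nat.le_induction with
  | base => exact subset_rfl
  | succ j _ ih => intro k hk; rw [SS_succ] at hk; exact ih hk.1

lemma dd_later (f : Z) {i j : ℕ} (h : i < j) : dd f i < dd f j ∧
    (inf0 f i ↔ ¬ conf (val f (dd f i)) (val f (dd f j))) := by
  have := SS_anti f (Nat.succ_le_of_lt h) (dd_mem f j)
  rw [Nat.succ_eq_add_one, SS_succ] at this
  exact this.2

lemma dd_strictMono (f : Z) : StrictMono (dd f) := fun _ _ h => (dd_later f h).1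

def D0 (f : Z) (m : ℕ) : Prop := Function.Injective f ∧ ∃ i, dd f i = m ∧ inf0 f i
def D1 (f : Z) (m : ℕ) : Prop := Function.Injective f ∧
  (∃ i, dd f i = m ∧ ¬ inf0 f i) ∧ ∃ s, (val f m).1 = .inr s

lemma D0_nconf {f m m'} (h : D0 f m) (h' : D0 f m') (hne : m ≠ m') : ¬ conf (val f m) (val f m') := by
  obtain ⟨_, i, rfl, hi⟩ := h
  obtain ⟨_, j, rfl, hj⟩ := h'
  rcases lt_trichotomy i j with hij | hij | hij
  · exact (dd_later f hij).2.1 hi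
  · subst hij; exact absurd rfl hne
  · exact fun hc => (dd_later f hij).2.1 hj hc.symm

lemma conf_root {v v' s} (h : conf v v') (hs : v.1 = .inr s) : Coh v v' := by
  rcases h with h | ⟨q, p, p', h1, _⟩
  · exact h
  · rw [hs] at h1; cases h1

lemma D1_coh_self {f m} (h : D1 f m) : Coh (val f m) (val f m) := by
  obtain ⟨_, ⟨i, rfl, hi⟩, s, hs⟩ := h
  have := (dd_later f (Nat.lt_succ_self i)).2
  have h2 : conf (val f (dd f i)) (val f (dd f (i+1))) := by
    by_contra hc; exact hi (this.2 hc)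
  exact (conf_root h2 hs).self

lemma D1_coh {f m m'} (h : D1 f m) (h' : D1 f m') : Coh (val f m) (val f m') := by
  have hself := D1_coh_self h
  obtain ⟨_, ⟨i, rfl, hi⟩, s, hs⟩ := h
  obtain ⟨_, ⟨j, rfl, hj⟩, s', hs'⟩ := h'
  rcases lt_trichotomy i j with hij | hij | hij
  · refine conf_root ?_ hs
    by_contra hc; exact hi ((dd_later f hij).2.2 hc)
  · subst hij; exact hself
  · refine (conf_root ?_ hs').symm
    by_contra hc; exact hj ((dd_later f hij).2.2 hc)

lemma D01_inf {f : Z} (hf : Function.Injective f) (h0 : {m | D0 f m}.Finite) : {m | D1 f m}.Infinite := by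
  -- eventually not inf0
  have h1 : {i | inf0 f i}.Finite := by
    apply Set.Finite.of_finite_image (f := dd f) _ (dd_strictMono f).injective.injOn
    apply h0.subset
    rintro _ ⟨i, hi, rfl⟩
    exact ⟨hf, i, rfl, hi⟩
  obtain ⟨N, hN⟩ := h1.bddAbove
  have hN' : ∀ i, N < i → ¬ inf0 f i := fun i hi h => absurd (hN h) (by omega)
  have hc : ∀ i j, N < i → i < j → conf (val f (dd f i)) (val f (dd f j)) := by
    intro i j hi hij
    by_contra hc; exact hN' i hi ((dd_later f hij).2.2 hc)
  have hroot : ∀ i, N < i → ∃ s, (val f (dd f i)).1 = .inr s := by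
    intro i hi
    by_contra hns
    have hnb : ∀ j, i < j → nb (val f (dd f i)) (val f (dd f j)) := by
      intro j hij
      rcases hc i j hi hij with ⟨s, s', h, _⟩ | h
      · exact absurd ⟨s, h⟩ hns
      · exact h
    obtain ⟨q, p, _, hq, _⟩ := hnb (i+1) (by omega)
    have hall : ∀ j, i < j → ∃ p', (val f (dd f j)).1 = .inl (q, p') ∧ p' ≤ q := by
      intro j hij
      obtain ⟨q1, p1, p2, h1, h2, h3, h4, h5⟩ := hnb j hij
      rw [hq] at h1
      injection h1 with h1; injection h1 with h1 h1'
      subst h1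
      exact ⟨p2, h2, h4⟩
    choose! P hP hPq using hall
    have hinj : Set.InjOn P (Set.Ioi i) := by
      intro j hj k hk hjk
      by_contra hne
      wlog hlt : j < k generalizing j k
      · exact this hk hj hjk.symm (Ne.symm hne) (by omega)
      have hj' : i < j := hj
      rcases hc j k (by omega) hlt with ⟨s, s', h, _⟩ | ⟨q1, p1, p2, h1, h2, h3, h4, h5⟩
      · rw [hP j hj] at h; cases h
      · rw [hP j hj] at h1; rw [hP k hk] at h2
        simp only [Sum.inl.injEq, Prod.mk.injEq] at h1 h2
        apply h5; rw [← h1.2, ← h2.2, hjk]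
    have : (Set.Ioi i).Finite := by
      apply Set.Finite.of_finite_image _ hinj
      apply (Set.finite_Iic q).subset
      rintro _ ⟨j, hj, rfl⟩
      exact hPq j hj
    exact Set.Ioi_infinite i this
  intro hfin
  have : (dd f '' Set.Ioi N).Infinite :=
    (Set.Ioi_infinite N).image (dd_strictMono f).injective.injOn
  apply this
  apply hfin.subset
  rintro _ ⟨i, hi, rfl⟩
  exact ⟨hf, ⟨i, rfl, hN' i hi⟩, hroot i hi⟩

noncomputable def phi (f : Z) : Z := fun i => sInf {a | ∃ m, D1 f m ∧ (lbl f m)[i]? = some a}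

lemma cmp_getElem? {s s' : List ℕ} (h : cmp s s') {i a a' : ℕ} (h1 : s[i]? = some a) (h2 : s'[i]? = some a') :
    a = a' := by
  rcases h with h | h
  · obtain ⟨t, rfl⟩ := h
    have hi : i < s.length := (List.getElem?_eq_some_iff.1 h1).1
    rw [List.getElem?_append_left hi, h1] at h2
    exact Option.some.inj h2
  · obtain ⟨t, rfl⟩ := h
    have hi : i < s'.length := (List.getElem?_eq_some_iff.1 h2).1
    rw [List.getElem?_append_left hi, h2] at h1
    exact (Option.some.inj h1).symm

lemma eq_pre_of_getElem? {s : List ℕ} {g : Z} (h : ∀ i a, s[i]? = some a → g i = a) :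
    s = pre g s.length := by
  apply List.ext_getElem?
  intro i
  rw [pre_getElem?]
  split_ifs with hi
  · rw [List.getElem?_eq_getElem hi, h i _ (List.getElem?_eq_getElem hi)]
  · simpa using hi

lemma D1_lbl {f m} (h : D1 f m) : (val f m).1 = .inr (lbl f m) := by
  obtain ⟨_, _, s, hs⟩ := h
  simp [lbl, lblV, hs]

lemma phi_spec {f m} (h : D1 f m) : lbl f m = pre (phi f) (lbl f m).length := by
  apply eq_pre_of_getElem?
  intro i a ha
  have hne : {a | ∃ m, D1 f m ∧ (lbl f m)[i]? = some a}.Nonempty := ⟨a, m, h, ha⟩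
  obtain ⟨m', hm', ha'⟩ := Nat.sInf_mem hne
  obtain ⟨s, s', h1, h2, h3, _⟩ := D1_coh hm' h
  rw [D1_lbl hm'] at h1; rw [D1_lbl h] at h2
  injection h1 with h1; injection h2 with h2
  subst h1; subst h2
  exact cmp_getElem? h3 ha' ha

noncomputable def Phi (x : Z × ℕ) : Z × ℕ := (phi x.1, (lbl x.1 x.2).length)

noncomputable def key (x : Z × ℕ) : ℕ := cd (R x.1 x.2)

def Rem (f : Z) (m : ℕ) : Prop := (∃ l, 0 < l ∧ Phi^[l] (f, m) = (f, m)) ∧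
  ∀ i, D1 (Phi^[i] (f, m)).1 (Phi^[i] (f, m)).2 ∧ key (f, m) ≤ key (Phi^[i] (f, m))

def D (f : Z) (m : ℕ) : Prop := D0 f m ∨ (D1 f m ∧ ¬ Rem f m)

lemma D.inj {f m} (h : D f m) : Function.Injective f := by
  rcases h with h | h
  · exact h.1
  · exact h.1.1

lemma D_hit {f m m' q p p'} (h : D f m) (h' : D f m') (hv : (val f m).1 = .inl (q, p))
    (hv' : (val f m').1 = .inl (q, p')) (hp : p ≤ q) (hp' : p' ≤ q) : p = p' := by
  by_contra hne
  have h0 : ∀ {m q p}, D f m → (val f m).1 = .inl (q, p) → D0 f m := by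
    intro m q p h hv
    rcases h with h | ⟨⟨_, _, s, hs⟩, _⟩
    · exact h
    · rw [hs] at hv; cases hv
  have hmm : m ≠ m' := by
    rintro rfl; rw [hv] at hv'; simp at hv'; exact hne hv'
  exact D0_nconf (h0 h hv) (h0 h' hv') hmm (Or.inr ⟨q, p, p', hv, hv', hp, hp', hne⟩)

end MCG

namespace MCG
open Filter

variable (d : Z → Z)

def sq (f : Z) (b : B) : Z := match b with
  | .inl _ => fun i => Nat.pair (f i) (d f i)
  | .inr _ => f

lemma sq_eq {f g : Z} {b : B} {i : ℕ} (h : sq d f b i = sq d g b i) : f i = g i := by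
  unfold sq at h
  cases b with
  | inl x => exact (Nat.pair_eq_pair.1 h).1
  | inr x => exact h

noncomputable def lab (f : Z) (u : V) : List ℕ := pre (sq d f u.1) (mm u.1 u.2)
noncomputable def up (f : Z) (u : V) : V := (u.1, lab d f u :: u.2)
def dn (f : Z) (u : V) : Prop := dnx (sq d f u.1) u.1 u.2

lemma dn_nil (f : Z) (b : B) : ¬ dn d f (b, []) := by simp [dn, dnx]

lemma dn_cons (f : Z) (b : B) (s r) : dn d f (b, s :: r) ↔ s = lab d f (b, r) ∧ ¬ dn d f (b, r) := by
  simp [dn, dnx, lab]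

lemma dn_up (f : Z) (u : V) : dn d f (up d f u) ↔ ¬ dn d f u := by
  simp [dn, up, dnx, lab]

lemma dn_exists {f : Z} {v : V} (h : dn d f v) : v = up d f (v.1, v.2.tail) ∧ ¬ dn d f (v.1, v.2.tail) := by
  obtain ⟨b, st⟩ := v
  cases st with
  | nil => exact absurd h (dn_nil d f b)
  | cons s r => rw [dn_cons] at h; exact ⟨by simp [up, ← h.1], h.2⟩

lemma up_inj {f g : Z} {u v : V} (h : up d f u = up d g v) : u = v ∧ lab d f u = lab d g u := by
  simp only [up, Prod.mk.injEq, List.cons.injEq] at h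
  have : u = v := Prod.ext h.1 h.2.2
  subst this
  exact ⟨rfl, h.2.1⟩

lemma up_inj_self {f : Z} {u v : V} (h : up d f u = up d f v) : u = v := (up_inj d h).1

lemma lab_eq {f g : Z} {u : V} (h : lab d f u = lab d g u) : ∀ i < mm u.1 u.2, f i = g i :=
  fun i hi => sq_eq d (pre_eq_iff.1 h i hi)

lemma dn_up_of {f g : Z} {u : V} (h : dn d f (up d g u)) : ∀ i < mm u.1 u.2, f i = g i := by
  have h1 := (dn_exists d h).1
  obtain ⟨h2, h3⟩ := up_inj d h1
  exact fun i hi => (lab_eq d h3 i hi).symm.symm.symm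

lemma dn_up_01 {f g : Z} {u : V} (h : dn d f (up d g u)) : f 0 = g 0 ∧ f 1 = g 1 := by
  have := mm_ge_two u.1 u.2
  exact ⟨dn_up_of d h 0 (by omega), dn_up_of d h 1 (by omega)⟩

def cst (c : ℕ) : Z := fun _ => c

lemma not_dn_cst {f : Z} {c : ℕ} {u : V} (hf : f 0 ≠ f 1) : ¬ dn d f (up d (cst c) u) := by
  intro h
  obtain ⟨h1, h2⟩ := dn_up_01 d h
  simp only [cst] at h1 h2
  exact hf (h1.trans h2.symm)

lemma not_D_cst (c m : ℕ) : ¬ D (cst c) m := by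
  intro h
  have := h.inj (show cst c 0 = cst c 1 from rfl)
  omega

lemma D.ne {f m} (h : D f m) : f 0 ≠ f 1 := fun h' => by
  have := h.inj h'; omega

open Classical in
noncomputable def tau (f : Z) (m : ℕ) : ℕ := if dn d (cst 0) (val f m) then 1 else 0

noncomputable def T (f : Z) (m : ℕ) : V := up d (cst (tau d f m)) (val f m)

lemma tau_le (f m) : tau d f m ≤ 1 := by unfold tau; split_ifs <;> simp

lemma cst_ne {c c' : ℕ} {u : V} (h : c ≠ c') : ¬ dn d (cst c) (up d (cst c') u) := by
  intro h'
  exact h (dn_up_01 d h').1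

lemma tau_not_dn (f m) : ¬ dn d (cst (tau d f m)) (val f m) := by
  unfold tau
  split_ifs with h
  · intro h'
    rw [(dn_exists d h).1] at h'
    exact cst_ne d (by norm_num) h'
  · exact h

lemma T_dn (f m) : dn d (cst (tau d f m)) (T d f m) := (dn_up d _ _).2 (tau_not_dn d f m)

noncomputable def r (f : Z) (m : ℕ) : ℕ → V
  | 0 => R f m
  | k + 1 => up d (cst (2 + k % 2)) (r f m k)

noncomputable def y (f : Z) (m : ℕ) : ℕ → V
  | 0 => T d f m
  | 1 => up d f (T d f m)
  | k + 2 => up d f (r d f m k)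

lemma r_fst (f m k) : (r d f m k).1 = .inr (pre f m) := by
  induction k with
  | zero => rfl
  | succ k ih => simpa [r, up] using ih

lemma r_len (f m k) : (r d f m k).2.length = k := by
  induction k with
  | zero => rfl
  | succ k ih => simpa [r, up] using ih

lemma r_inj {f m m' k k'} (h : r d f m k = r d f m' k') : m = m' ∧ k = k' := by
  constructor
  · have := congrArg Prod.fst h
    rw [r_fst, r_fst] at this
    injection this with this
    exact (pre_inj this).1
  · have := congrArg (fun v => v.2.length) h
    simpa [r_len] using this

lemma r_not_dn {f : Z} (hf : f 0 ≠ f 1) (m k) : ¬ dn d f (r d f m k) := by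
  cases k with
  | zero => exact dn_nil d _ _
  | succ k => exact not_dn_cst d hf

lemma T_not_dn {f : Z} (hf : f 0 ≠ f 1) (m) : ¬ dn d f (T d f m) := not_dn_cst d hf

lemma r_not_dn_cst (f m k) : ¬ dn d (cst (2 + k % 2)) (r d f m k) := by
  cases k with
  | zero => exact dn_nil d _ _
  | succ k => exact cst_ne d (by omega)

lemma T_ne_r (f m m' k) : T d f m ≠ r d f m' k := by
  intro h
  have h1 := T_dn d f m
  rw [h] at h1
  cases k with
  | zero => exact dn_nil d _ _ h1
  | succ k =>
    have := tau_le d f m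
    exact cst_ne d (by omega) h1

lemma T_inj {f : Z} (hf : Function.Injective f) {m m'} (h : T d f m = T d f m') : m = m' :=
  val_inj hf (up_inj d h).1

lemma y_succ_dn {f : Z} (hf : f 0 ≠ f 1) (m k) : dn d f (y d f m (k+1)) := by
  cases k with
  | zero => exact (dn_up d _ _).2 (T_not_dn d hf m)
  | succ k => exact (dn_up d _ _).2 (r_not_dn d hf m k)

lemma y_ne_r {f : Z} (hf : f 0 ≠ f 1) (m m' k k') : y d f m k ≠ r d f m' k' := by
  cases k with
  | zero => exact T_ne_r d f m m' k'
  | succ k =>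
    intro h
    have := y_succ_dn d hf m k
    rw [h] at this
    exact r_not_dn d hf _ _ this

lemma y_inj {f : Z} (hf : Function.Injective f) {m m' k k'} (h : y d f m k = y d f m' k') :
    m = m' ∧ k = k' := by
  have hf' : f 0 ≠ f 1 := fun h => by have := hf h; omega
  rcases k with _ | _ | k <;> rcases k' with _ | _ | k'
  · exact ⟨T_inj d hf h, rfl⟩
  · have := y_succ_dn d hf' m' 0
    rw [← h] at this
    exact absurd this (T_not_dn d hf' m)
  · have := y_succ_dn d hf' m' (k'+1)
    rw [← h] at this
    exact absurd this (T_not_dn d hf' m)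
  · have := y_succ_dn d hf' m 0
    rw [h] at this
    exact absurd this (T_not_dn d hf' m')
  · exact ⟨T_inj d hf (up_inj d h).1, rfl⟩
  · exact absurd (up_inj d h).1 (T_ne_r d _ _ _ _)
  · have := y_succ_dn d hf' m (k+1)
    rw [h] at this
    exact absurd this (T_not_dn d hf' m')
  · exact absurd (up_inj d h).1.symm (T_ne_r d _ _ _ _)
  · have := r_inj d (up_inj d h).1
    exact ⟨this.1, by omega⟩

open Classical in
noncomputable def sig (f : Z) (v : V) : V := if dn d f v then (v.1, v.2.tail) else up d f v

open Classical in
noncomputable def mate (f : Z) (v : V) : V :=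
  if h : ∃ x : ℕ × ℕ, D f x.1 ∧ v = r d f x.1 x.2 then y d f h.choose.1 h.choose.2
  else if h : ∃ x : ℕ × ℕ, D f x.1 ∧ v = y d f x.1 x.2 then r d f h.choose.1 h.choose.2
  else sig d f v

lemma mate_r {f m} (h : D f m) (k) : mate d f (r d f m k) = y d f m k := by
  have hx : ∃ x : ℕ × ℕ, D f x.1 ∧ r d f m k = r d f x.1 x.2 := ⟨(m, k), h, rfl⟩
  unfold mate
  rw [dif_pos hx]
  obtain ⟨h1, h2⟩ := r_inj d hx.choose_spec.2
  rw [← h1, ← h2]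

lemma mate_y {f m} (h : D f m) (k) : mate d f (y d f m k) = r d f m k := by
  have hx : ∃ x : ℕ × ℕ, D f x.1 ∧ y d f m k = y d f x.1 x.2 := ⟨(m, k), h, rfl⟩
  unfold mate
  rw [dif_neg, dif_pos hx]
  · obtain ⟨h1, h2⟩ := y_inj d h.inj hx.choose_spec.2
    rw [← h1, ← h2]
  · rintro ⟨x, _, h2⟩
    exact y_ne_r d h.ne _ _ _ _ h2

lemma mate_sig {f v} (h1 : ∀ m k, D f m → v ≠ r d f m k) (h2 : ∀ m k, D f m → v ≠ y d f m k) :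
    mate d f v = sig d f v := by
  unfold mate
  rw [dif_neg, dif_neg]
  · rintro ⟨x, hx, hv⟩; exact h2 _ _ hx hv
  · rintro ⟨x, hx, hv⟩; exact h1 _ _ hx hv

lemma sig_dn {f v} (h : dn d f v) : sig d f v = (v.1, v.2.tail) := by simp [sig, h]
lemma sig_ndn {f v} (h : ¬ dn d f v) : sig d f v = up d f v := by simp [sig, h]
lemma sig_up {f u} (h : ¬ dn d f u) : sig d f (up d f u) = u := by
  rw [sig_dn d ((dn_up d _ _).2 h)]; rfl

lemma sig_sig (f v) : sig d f (sig d f v) = v := by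
  by_cases h : dn d f v
  · rw [sig_dn d h]
    obtain ⟨h1, h2⟩ := dn_exists d h
    rw [sig_ndn d h2]
    exact h1.symm
  · rw [sig_ndn d h, sig_up d h]

/-- the hotel -/
def Hot (f : Z) (v : V) : Prop := ∃ m k, D f m ∧ (v = r d f m k ∨ v = y d f m k)

lemma Hot_sig {f v} (h : Hot d f v) : Hot d f (sig d f v) := by
  obtain ⟨m, k, hD, rfl | rfl⟩ := h
  · rw [sig_ndn d (r_not_dn d hD.ne m k)]
    exact ⟨m, k+2, hD, Or.inr rfl⟩
  · rcases k with _ | _ | k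
    · have : sig d f (y d f m 0) = y d f m 1 := sig_ndn d (T_not_dn d hD.ne m)
      rw [this]
      exact ⟨m, 1, hD, Or.inr rfl⟩
    · have : sig d f (y d f m 1) = y d f m 0 := sig_up d (T_not_dn d hD.ne m)
      rw [zero_add, this]
      exact ⟨m, 0, hD, Or.inr rfl⟩
    · have : sig d f (y d f m (k+2)) = r d f m k := sig_up d (r_not_dn d hD.ne m k)
      rw [this]
      exact ⟨m, k, hD, Or.inl rfl⟩

lemma mate_nHot {f v} (h : ¬ Hot d f v) : mate d f v = sig d f v :=
  mate_sig d (fun m k hD hv => h ⟨m, k, hD, Or.inl hv⟩) (fun m k hD hv => h ⟨m, k, hD, Or.inr hv⟩)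

lemma mate_mate (f : Z) : Function.Involutive (mate d f) := by
  intro v
  by_cases h : Hot d f v
  · obtain ⟨m, k, hD, rfl | rfl⟩ := h
    · rw [mate_r d hD, mate_y d hD]
    · rw [mate_y d hD, mate_r d hD]
  · have h' : ¬ Hot d f (sig d f v) := fun h' => h (by simpa [sig_sig] using Hot_sig d h')
    rw [mate_nHot d h, mate_nHot d h', sig_sig]

lemma up_ne (f : Z) (v : V) : up d f v ≠ v := by
  intro h
  have := congrArg (fun v => v.2.length) h
  simp [up] at this

lemma mate_ne (f v) : mate d f v ≠ v := by
  by_cases h : Hot d f v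
  · obtain ⟨m, k, hD, rfl | rfl⟩ := h
    · rw [mate_r d hD]; exact y_ne_r d hD.ne _ _ _ _
    · rw [mate_y d hD]; exact (y_ne_r d hD.ne _ _ _ _).symm
  · rw [mate_nHot d h]
    by_cases h : dn d f v
    · rw [sig_dn d h]
      have := (dn_exists d h).1
      intro h'
      rw [h'] at this
      exact up_ne d f v this.symm
    · rw [sig_ndn d h]; exact up_ne d f v

noncomputable def mateP (f : Z) : Equiv.Perm V := (mate_mate d f).toPerm
@[simp] lemma mateP_apply (f v) : mateP d f v = mate d f v := rfl
lemma mateP_sq (f) : mateP d f * mateP d f = 1 := by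
  ext1 v; exact mate_mate d f v

def GG : Subgroup (Equiv.Perm V) := Subgroup.closure (Set.range (mateP d))

def Upper (f : Z) (v : V) : Prop := dn d f v ∨ ∃ m, D f m ∧ v = R f m

lemma Upper_or (f v) : Upper d f v ∨ Upper d f (mate d f v) := by
  by_cases h : Hot d f v
  · obtain ⟨m, k, hD, rfl | rfl⟩ := h
    · rw [mate_r d hD]
      cases k with
      | zero => left; right; exact ⟨m, hD, rfl⟩
      | succ k => right; left; exact y_succ_dn d hD.ne m k
    · rw [mate_y d hD]
      cases k with
      | zero => right; right; exact ⟨m, hD, rfl⟩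
      | succ k => left; left; exact y_succ_dn d hD.ne m k
  · rw [mate_nHot d h]
    by_cases h : dn d f v
    · exact Or.inl (Or.inl h)
    · rw [sig_ndn d h]; right; left; exact (dn_up d _ _).2 h

lemma Upper_fin {f g : Z} (hfg : f ≠ g) : {v | Upper d f v ∧ Upper d g v}.Finite := by
  obtain ⟨i, hi⟩ := Function.ne_iff.1 hfg
  apply (((mm_fin i).image (up d f)).union ((Set.finite_Iic i).image (R f))).subset
  rintro v ⟨h | ⟨m, hD, rfl⟩, h' | ⟨m', hD', h'⟩⟩
  · left
    obtain ⟨h1, _⟩ := dn_exists d h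
    refine ⟨_, ?_, h1.symm⟩
    rw [h1] at h'
    by_contra hc
    simp only [Set.mem_setOf_eq, not_le] at hc
    exact hi (dn_up_of d h' i hc).symm
  · rw [h'] at h; exact absurd h (dn_nil d _ _)
  · exact absurd h' (dn_nil d _ _)
  · right
    refine ⟨m, ?_, rfl⟩
    by_contra hc
    exact hi ((R_inj h').2 i (by simpa using hc))

lemma dn_mate {f v} (h : dn d f v) : mate d f v = (v.1, v.2.tail) ∨
    ∃ m k, D f m ∧ v = y d f m (k+1) ∧ mate d f v = r d f m (k+1) := by
  by_cases hH : Hot d f v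
  · right
    obtain ⟨m, k, hD, rfl | rfl⟩ := hH
    · exact absurd h (r_not_dn d hD.ne m k)
    · cases k with
      | zero => exact absurd h (T_not_dn d hD.ne m)
      | succ k => exact ⟨m, k, hD, rfl, mate_y d hD _⟩
  · left; rw [mate_nHot d hH, sig_dn d h]

lemma mate_cst (c v) : mate d (cst c) v = sig d (cst c) v :=
  mate_sig d (fun m _ hD => absurd hD (not_D_cst c m)) (fun m _ hD => absurd hD (not_D_cst c m))

end MCG

namespace MCG
open Filter
variable (d : Z → Z)

inductive Chain : List Z → V → V → Prop
  | nil (u : V) : Chain [] u u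
  | cons {W : List Z} {v u : V} (h : Z) : Chain W v u → ¬ dn d h v → Chain (h :: W) (up d h v) u

noncomputable def Up : List Z → V → V
  | [], u => u
  | h :: W, u => up d h (Up W u)

lemma Chain.eq {W v u} (h : Chain d W v u) : v = Up d W u := by
  induction h with
  | nil u => rfl
  | cons h _ _ ih => rw [ih]; rfl

lemma Chain.fst {W v u} (h : Chain d W v u) : v.1 = u.1 := by
  induction h with
  | nil u => rfl
  | cons h _ _ ih => exact ih

lemma Chain.prp {W v g m} (h : Chain d W v (R g m)) : Prp v.1 v.2 := by
  generalize hu : R g m = u at h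
  induction h with
  | nil u => subst hu; trivial
  | @cons W v u h hc hn ih =>
    have hf := hc.fst
    have hs : sq d h v.1 = h := by rw [hf, ← hu]; rfl
    refine ⟨ih hu, by simp [lab]; rfl, ?_⟩
    simp only [lab, up]
    rw [← dnx_iff_dnl _ _ _ _ le_rfl]
    exact hn

lemma Chain.forall₂ {W v v' g m m'} (h : Chain d W v (R g m)) (h' : Chain d W v' (R g m')) :
    List.Forall₂ cmp v.2 v'.2 := by
  generalize hu : R g m = u at h
  generalize hu' : R g m' = u' at h'
  induction h generalizing v' u' with
  | nil u => cases h'; subst hu; subst hu'; exact List.Forall₂.nil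
  | @cons W v u h hc hn ih =>
    cases h' with
    | @cons _ v' _ _ hc' hn' =>
    refine List.Forall₂.cons ?_ (ih hu _ hu' hc')
    have hf := hc.fst
    have hs : sq d h v.1 = h := by rw [hf, ← hu]; rfl
    have hf' := hc'.fst
    have hs' : sq d h v'.1 = h := by rw [hf', ← hu']; rfl
    rw [lab, lab, hs, hs']
    exact cmp_pre _ _ _

lemma Chain.coh {W v v' g m m'} (h : Chain d W v (R g m)) (h' : Chain d W v' (R g m')) :
    Coh v v' :=
  ⟨pre g m, pre g m', h.fst, h'.fst, cmp_pre _ _ _, h.forall₂ d h', h.prp, h'.prp⟩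

lemma limit_aux (g : Z) (n : ℕ) : ∀ E : Set V, (∀ v ∈ E, v.2.length = n) →
    (∀ v ∈ E, ∀ v' ∈ E, Coh v v') → (∀ v ∈ E, ∃ m, v.1 = .inr (pre g m)) →
    ∃ W, ∀ v ∈ E, ∃ m, Chain d W v (R g m) := by
  induction n with
  | zero =>
    intro E h1 h2 h3
    refine ⟨[], fun v hv => ?_⟩
    obtain ⟨m, hm⟩ := h3 v hv
    have : v = R g m := Prod.ext hm (List.length_eq_zero_iff.1 (h1 v hv))
    exact ⟨m, this ▸ Chain.nil _⟩
  | succ n ih =>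
    intro E h1 h2 h3
    have hform : ∀ v ∈ E, ∃ b s t, v = (b, s :: t) := by
      rintro ⟨b, st⟩ hv
      cases st with
      | nil => exact absurd (h1 _ hv) (by simp)
      | cons s t => exact ⟨b, s, t, rfl⟩
    obtain ⟨W, hW⟩ := ih ((fun v : V => (v.1, v.2.tail)) '' E) (by
        rintro _ ⟨v, hv, rfl⟩; simp [h1 v hv]) (by
        rintro _ ⟨v, hv, rfl⟩ _ ⟨v', hv', rfl⟩
        obtain ⟨s, s', h4, h5, h6, h7, h8, h9⟩ := h2 v hv v' hv'
        obtain ⟨b, a, t, rfl⟩ := hform v hv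
        obtain ⟨b', a', t', rfl⟩ := hform v' hv'
        exact ⟨s, s', h4, h5, h6, (List.forall₂_cons.1 h7).2, h8.1, h9.1⟩) (by
        rintro _ ⟨v, hv, rfl⟩; exact h3 v hv)
    let h : Z := fun i => sInf {a | ∃ b s t, ((b, s :: t) : V) ∈ E ∧ s[i]? = some a}
    have hh : ∀ b s t, ((b, s :: t) : V) ∈ E → s = pre h s.length := by
      intro b s t hE
      apply eq_pre_of_getElem?
      intro i a ha
      have hne : {a | ∃ b s t, ((b, s :: t) : V) ∈ E ∧ s[i]? = some a}.Nonempty := ⟨a, b, s, t, hE, ha⟩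
      obtain ⟨b', s', t', hE', ha'⟩ := Nat.sInf_mem hne
      obtain ⟨_, _, _, _, _, h7, _⟩ := h2 _ hE' _ hE
      exact cmp_getElem? (List.forall₂_cons.1 h7).1 ha' ha
    refine ⟨h :: W, fun v hv => ?_⟩
    obtain ⟨m, hm⟩ := hW _ ⟨v, hv, rfl⟩
    refine ⟨m, ?_⟩
    obtain ⟨b, s, t, rfl⟩ := hform v hv
    obtain ⟨_, _, _, _, _, _, h8, _⟩ := h2 _ hv _ hv
    obtain ⟨_, h9, h10⟩ := h8
    have hs := hh b s t hv
    obtain ⟨m', hb⟩ := h3 _ hv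
    simp only at hb h9 h10 hm
    have hsq : sq d h b = h := by rw [hb]; rfl
    rw [h9] at hs
    have hup : up d h (b, t) = (b, s :: t) := by simp [up, lab, hsq, ← hs]
    have := Chain.cons (d := d) h hm (by
      simp only [dn, hsq]
      rw [dnx_iff_dnl _ _ _ _ le_rfl, List.tail_cons, ← hs]
      exact h10)
    simp only [List.tail_cons] at this
    rwa [hup] at this

lemma limit (g : Z) (E : Set V) (h2 : ∀ v ∈ E, ∀ v' ∈ E, Coh v v')
    (h3 : ∀ v ∈ E, ∃ m, v.1 = .inr (pre g m)) :
    ∃ W, ∀ v ∈ E, ∃ m, Chain d W v (R g m) := by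
  rcases E.eq_empty_or_nonempty with rfl | ⟨v0, hv0⟩
  · exact ⟨[], by simp⟩
  · apply limit_aux d g v0.2.length E _ h2 h3
    intro v hv
    obtain ⟨_, _, _, _, _, h7, _⟩ := h2 _ hv _ hv0
    exact h7.length_eq

lemma fin1 (g : Z) (W : List Z) (g' : Z) :
    {m | D g m ∧ (∃ m', Chain d W (val g m) (R g' m')) ∧ (D0 g m ∨ g' ≠ phi g)}.Finite := by
  have A : {m | D0 g m ∧ ∃ m', Chain d W (val g m) (R g' m')}.Finite := by
    apply Set.Subsingleton.finite
    rintro m ⟨h, m', hm⟩ n ⟨h', n', hn⟩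
    by_contra hne
    exact D0_nconf h h' hne (Or.inl (hm.coh d hn))
  have B : {m | D1 g m ∧ (∃ m', Chain d W (val g m) (R g' m')) ∧ g' ≠ phi g}.Finite := by
    by_cases hg : Function.Injective g ∧ g' ≠ phi g
    · obtain ⟨i, hi⟩ := Function.ne_iff.1 hg.2
      apply Set.Finite.of_finite_image (f := val g) _ (fun a _ b _ h => val_inj hg.1 h)
      apply (((Set.finite_Iic i).image (R g')).image (Up d W)).subset
      rintro _ ⟨m, ⟨hD, ⟨m', hm⟩, _⟩, rfl⟩
      refine ⟨_, ⟨m', ?_, rfl⟩, hm.eq.symm⟩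
      by_contra hc
      have h1 := D1_lbl hD
      rw [phi_spec hD, hm.fst] at h1
      have h1 : pre g' m' = _ := Sum.inr.inj h1
      exact hi ((pre_inj h1).2 i (by simpa using hc))
    · convert Set.finite_empty
      ext m
      simp only [Set.mem_ofPred_eq, Set.mem_empty_iff_false, iff_false]
      rintro ⟨h, _, h'⟩
      exact hg ⟨h.1, h'⟩
  apply (A.union B).subset
  rintro m ⟨hD, hm, h⟩
  by_cases h0 : D0 g m
  · exact Or.inl ⟨h0, hm⟩
  · right
    exact ⟨(hD.resolve_left h0).1, hm, h.resolve_left h0⟩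

end MCG

namespace MCG
open Filter
variable (d : Z → Z)

def BadS (F : Set Z) : Set V := ⋃ f ∈ F, ⋃ g ∈ F, {v | f ≠ g ∧ Upper d f v ∧ Upper d g v}

lemma BadS_fin {F : Set Z} (hF : F.Finite) : (BadS d F).Finite := by
  refine hF.biUnion fun f _ => hF.biUnion fun g _ => ?_
  by_cases h : f = g
  · simp [h]
  · exact (Upper_fin d h).subset fun v hv => hv.2

def WS (F : Set Z) (L : ℕ) : Set (List Z) := {W | W.length ≤ L ∧ ∀ h ∈ W, h ∈ F}

lemma WS_fin {F : Set Z} (hF : F.Finite) (L : ℕ) : (WS F L).Finite := by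
  have : Finite F := hF
  apply ((List.finite_length_le F L).image (List.map Subtype.val)).subset
  rintro W ⟨h1, h2⟩
  refine ⟨W.attach.map fun x => ⟨x.1, h2 x.1 x.2⟩, by simpa using h1, ?_⟩
  simp [Function.comp_def]

def ExV (F : Set Z) (L : ℕ) : Set V := ⋃ g ∈ F, ⋃ W ∈ WS F L, ⋃ g' ∈ F,
  R g '' {m | D g m ∧ (∃ m', Chain d W (val g m) (R g' m')) ∧ (D0 g m ∨ g' ≠ phi g)}

lemma ExV_fin {F : Set Z} (hF : F.Finite) (L : ℕ) : (ExV d F L).Finite :=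
  hF.biUnion fun g _ => (WS_fin hF L).biUnion fun W _ => hF.biUnion fun g' _ => (fin1 d g W g').image _

structure Path (F : Set Z) (L : ℕ) (a : ℕ → Z) (v : ℕ → V) : Prop where
  hL : 0 < L
  hF : F.Finite
  h2 : cst 2 ∈ F
  h3 : cst 3 ∈ F
  ha : ∀ i, a i ∈ F
  hbad : ∀ i, v i ∉ BadS d F
  hex : ∀ i, v i ∉ ExV d F L
  hv : ∀ i, v (i+1) = mate d (a i) (v i)
  hup : ∀ i, Upper d (a i) (v i)
  hper : Function.Periodic v L

variable {d}
namespace Path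
variable {F : Set Z} {L : ℕ} {a : ℕ → Z} {v : ℕ → V} (P : Path d F L a v)
include P

lemma uniq {f i} (hf : f ∈ F) (h : Upper d f (v i)) : a i = f := by
  by_contra hne
  apply P.hbad i
  simp only [BadS, Set.mem_iUnion]
  exact ⟨a i, P.ha i, f, hf, hne, P.hup i, h⟩

lemma step_r {f m k i} (h : v i = r d f m (k+1)) : v (i+1) = r d f m k := by
  have hd : dn d (cst (2 + k % 2)) (v i) := by
    rw [h]; exact (dn_up d _ _).2 (r_not_dn_cst d f m k)
  have hm : cst (2 + k % 2) ∈ F := by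
    rcases Nat.mod_two_eq_zero_or_one k with h | h <;> rw [h]
    · exact P.h2
    · exact P.h3
  rw [P.hv, P.uniq hm (Or.inl hd), mate_cst, h]
  exact sig_up d (r_not_dn_cst d f m k)

lemma root_step {f m i} (hf : f ∈ F) (hD : D f m) (h : v i = R f m) : v (i+1) = T d f m := by
  rw [P.hv, P.uniq hf (Or.inr ⟨m, hD, h⟩), h]
  exact mate_r d hD 0

lemma S {i b s t} (h : v i = (b, s :: t)) : dn d (a i) (v i) ∧ ∃ j, v j = (b, t) := by
  have hd : dn d (a i) (v i) := by
    rcases P.hup i with h' | ⟨m, _, h'⟩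
    · exact h'
    · rw [h'] at h; simp [R] at h
  refine ⟨hd, ?_⟩
  rcases dn_mate d hd with h' | ⟨m, k, hD, h1, h2⟩
  · exact ⟨i+1, by rw [P.hv, h', h]; rfl⟩
  · rw [← P.hv] at h2
    cases k with
    | zero =>
      have h3 := P.step_r h2
      have h4 := P.root_step (P.ha i) hD h3
      refine ⟨_, h4.trans ?_⟩
      rw [h1] at h
      have := congrArg (fun u : V => ((u.1, u.2.tail) : V)) h
      exact this
    | succ k =>
      have h3 := P.step_r h2
      have h4 := P.step_r h3
      refine ⟨_, h4.trans ?_⟩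
      rw [h1] at h
      have := congrArg (fun u : V => ((u.1, u.2.tail) : V)) h
      exact this

lemma C (b : B) (st : List (List ℕ)) : ∀ i, v i = (b, st) →
    ∃ W, Chain d W (v i) (b, []) ∧ (∀ h ∈ W, h ∈ F) ∧ W.length = st.length ∧ (∃ j, v j = (b, [])) ∧
      ∀ k ≤ st.length, ∃ j, (v j).2.length = k := by
  induction st with
  | nil => intro i hi; exact ⟨[], hi ▸ Chain.nil _, by simp, rfl, ⟨i, hi⟩, fun k hk => ⟨i, by simp_all⟩⟩
  | cons s t ih =>
    intro i hi
    obtain ⟨hd, j, hj⟩ := P.S hi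
    obtain ⟨W, hW, hWF, hl, hr, hk⟩ := ih j hj
    obtain ⟨h1, h2⟩ := dn_exists d hd
    have h3 : ((v i).1, (v i).2.tail) = v j := by rw [hi, hj]; rfl
    rw [h3] at h1 h2
    refine ⟨a i :: W, ?_, ?_, by simp [hl], hr, ?_⟩
    · rw [h1]; exact Chain.cons _ hW h2
    · simp only [List.mem_cons, forall_eq_or_imp]; exact ⟨P.ha i, hWF⟩
    · intro k hk'
      rcases Nat.lt_or_ge t.length k with h | h
      · exact ⟨i, by rw [hi]; simp at hk' ⊢; omega⟩
      · exact hk k h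

lemma len_le {i b st} (h : v i = (b, st)) : st.length ≤ L := by
  obtain ⟨_, _, _, _, _, hk⟩ := P.C b st i h
  have : Finset.range (st.length+1) ⊆ (Finset.range L).image (fun i => (v i).2.length) := by
    intro k hk'
    obtain ⟨j, hj⟩ := hk k (by simpa [Nat.lt_succ_iff] using hk')
    refine Finset.mem_image.2 ⟨j % L, by simpa using Nat.mod_lt _ P.hL, ?_⟩
    rw [P.hper.map_mod_nat, hj]
  have := (Finset.card_le_card this).trans Finset.card_image_le
  simp at this
  omega

/-- roots on the path -/
def Q (_ : Path d F L a v) : Set (Z × ℕ) := {x | x.1 ∈ F ∧ D x.1 x.2 ∧ ∃ i, v i = R x.1 x.2}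

lemma base (i : ℕ) : ∃ W, W ∈ WS F L ∧ ∃ g m, (g, m) ∈ P.Q ∧ Chain d W (v i) (R g m) := by
  obtain ⟨W, h1, h2, h3, ⟨j, hj⟩, _⟩ := P.C (v i).1 (v i).2 i rfl
  refine ⟨W, ⟨h3 ▸ P.len_le (i := i) rfl, h2⟩, ?_⟩
  rcases P.hup j with h | ⟨m, hD, h⟩
  · rw [hj] at h; exact absurd h (dn_nil d _ _)
  · exact ⟨a j, m, ⟨P.ha j, hD, j, h⟩, h ▸ hj ▸ h1⟩

lemma Q_fin : P.Q.Finite := by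
  have : (v '' Set.Iio L).Finite := (Set.finite_Iio L).image _
  apply Set.Finite.of_finite_image (f := fun x => (x.1, R x.1 x.2))
  · apply (P.hF.prod this).subset
    rintro _ ⟨x, ⟨h1, h2, i, hi⟩, rfl⟩
    exact ⟨h1, i % L, Nat.mod_lt _ P.hL, by rw [P.hper.map_mod_nat, hi]⟩
  · rintro ⟨f, m⟩ _ ⟨g, n⟩ _ h
    simp only [Prod.mk.injEq] at h
    exact Prod.ext h.1 (R_inj h.2).1

lemma Q_step {g m} (h : (g, m) ∈ P.Q) : D1 g m ∧ ¬ Rem g m ∧ Phi (g, m) ∈ P.Q := by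
  obtain ⟨hg, hD, i, hi⟩ := h
  obtain ⟨_, j, hj⟩ := P.S (P.root_step hg hD hi)
  have hj' : v j = val g m := hj
  obtain ⟨W, hW, g', m', hQ, hc⟩ := P.base j
  rw [hj'] at hc
  have hex : ¬ (D0 g m ∨ g' ≠ phi g) := by
    intro hx
    apply P.hex i
    simp only [ExV, Set.mem_iUnion]
    exact ⟨g, hg, W, hW, g', hQ.1, m, ⟨hD, ⟨m', hc⟩, hx⟩, hi.symm⟩
  push Not at hex
  have hD1 := hD.resolve_left hex.1
  refine ⟨hD1.1, hD1.2, ?_⟩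
  have h1 := D1_lbl hD1.1
  rw [hc.fst] at h1
  have h1 : pre g' m' = _ := Sum.inr.inj h1
  have : Phi (g, m) = (g', m') := by
    simp only [Phi, ← h1, pre_length, hex.2]
  rw [this]; exact hQ

lemma false : False := by
  obtain ⟨_, _, g, m, hQ, _⟩ := P.base 0
  have hit : ∀ x ∈ P.Q, ∀ i, Phi^[i] x ∈ P.Q := by
    intro x hx i
    induction i with
    | zero => exact hx
    | succ i ih => rw [Function.iterate_succ_apply']; exact (P.Q_step ih).2.2
  have hper : (P.Q ∩ Function.periodicPts Phi).Nonempty := by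
    have := Set.Finite.exists_lt_map_eq_of_forall_mem (f := fun i : ℕ => Phi^[i] (g, m)) (hit _ hQ) P.Q_fin
    obtain ⟨i, j, hij, h⟩ := this
    refine ⟨_, hit _ hQ i, ?_⟩
    refine Function.mk_mem_periodicPts (n := j - i) (by omega) ?_
    show Phi^[j-i] _ = _
    rw [← Function.iterate_add_apply, h]
    congr 2; omega
  obtain ⟨x, hx, hmin⟩ := Set.exists_min_image _ key (P.Q_fin.inter_of_left _) hper
  refine (P.Q_step hx.1).2.1 ⟨?_, ?_⟩
  · obtain ⟨l, hl, h⟩ := hx.2; exact ⟨l, hl, h⟩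
  · intro i
    have h1 := hit x hx.1 i
    refine ⟨(P.Q_step h1).1, hmin _ ⟨h1, ?_⟩⟩
    obtain ⟨l, hl, h⟩ := hx.2
    exact ⟨l, hl, h.apply_iterate i⟩

end Path

variable (d)
noncomputable def Wd (l : List Z) : Equiv.Perm V := (l.map (mateP d)).prod

lemma cyc_fin (l : List Z) (hl : l ≠ []) (h : ∀ i : ℕ, l[i % l.length]? ≠ l[(i+1) % l.length]?) :
    {v | Wd d l v = v}.Finite := by
  set L := l.length with hLdef
  have hL : 0 < L := List.length_pos_iff.2 hl
  let F : Set Z := {f | f ∈ l} ∪ {cst 2, cst 3}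
  have hF : F.Finite := (List.finite_toSet l).union (by simp)
  apply ((BadS_fin d hF).union (ExV_fin d hF L) |>.biUnion (t := fun b =>
    {v | ∃ k ≤ L, Wd d (l.drop k) v = b}) ?_).subset ?_
  · intro b _
    have : {v | ∃ k ≤ L, Wd d (l.drop k) v = b} ⊆ (fun k => (Wd d (l.drop k)).symm b) '' Set.Iic L := by
      rintro v ⟨k, hk, rfl⟩; exact ⟨k, hk, by simp⟩
    exact ((Set.finite_Iic L).image _).subset this
  intro v0 hv0
  by_contra hcon
  simp only [Set.mem_iUnion, not_exists] at hcon
  let u : ℕ → V := fun k => Wd d (l.drop k) v0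
  let a : ℕ → Z := fun k => l[k % L]'(Nat.mod_lt _ hL)
  let v : ℕ → V := fun k => u (k % L)
  have hu : ∀ k (hk : k < L), u (k+1) = mate d l[k] (u k) := by
    intro k hk
    have : u k = mate d l[k] (u (k+1)) := by
      simp only [u]; rw [List.drop_eq_getElem_cons hk]; rfl
    rw [this, mate_mate]
  have hu0 : u L = u 0 := by
    simp only [u, List.drop_zero, hLdef, List.drop_length]; exact hv0.symm
  have hv : ∀ k, v (k+1) = mate d (a k) (v k) := by
    intro k
    have hk := Nat.mod_lt k hL
    simp only [v, a]
    rw [← hu _ hk]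
    by_cases h1 : k % L + 1 = L
    · rw [h1, hu0]
      have : (k+1) % L = 0 := by rw [← Nat.mod_add_mod, h1, Nat.mod_self]
      rw [this]
    · have : (k+1) % L = k % L + 1 := by
        rw [← Nat.mod_add_mod, Nat.mod_eq_of_lt (by omega)]
      rw [this]
  have hper : Function.Periodic v L := fun k => by simp [v]
  have haper : Function.Periodic a L := fun k => by simp [a]
  have hane : ∀ k, a k ≠ a (k+1) := by
    intro k hk
    apply h k
    rw [List.getElem?_eq_getElem (Nat.mod_lt _ hL), List.getElem?_eq_getElem (Nat.mod_lt _ hL)]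
    exact congrArg some hk
  have haF : ∀ k, a k ∈ F := fun k => Or.inl (List.getElem_mem _)
  have hB : ∀ k, v k ∉ BadS d F ∧ v k ∉ ExV d F L := by
    intro k
    have := fun hx => hcon (v k) hx ⟨k % L, (Nat.mod_lt _ hL).le, rfl⟩
    simpa using this
  have huniq : ∀ f ∈ F, ∀ g ∈ F, ∀ k, Upper d f (v k) → Upper d g (v k) → f = g := by
    intro f hf g hg k h1 h2
    by_contra hne
    apply (hB k).1
    simp only [BadS, Set.mem_iUnion]
    exact ⟨f, hf, g, hg, hne, h1, h2⟩
  have h2F : cst 2 ∈ F := by simp [F]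
  have h3F : cst 3 ∈ F := by simp [F]
  by_cases hall : ∀ k, Upper d (a k) (v k)
  · exact Path.false ⟨hL, hF, h2F, h3F, haF, fun k => (hB k).1, fun k => (hB k).2, hv, hall, hper⟩
  · push Not at hall
    obtain ⟨k0, hk0⟩ := hall
    have hb : ∀ k, k0 ≤ k → Upper d (a k) (v (k+1)) := by
      intro k hk
      induction k, hk using Nat.le_induction with
      | base => rw [hv]; exact (Upper_or d _ _).resolve_left hk0
      | succ k _ ih =>
        rw [hv (k+1)]
        refine (Upper_or d _ _).resolve_left fun h' => ?_
        exact hane k (huniq _ (haF _) _ (haF _) _ ih h')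
    have hb' : ∀ k, Upper d (a k) (v (k+1)) := by
      intro k
      have := hb (k + k0 * L) (by nlinarith)
      have e1 : a (k + k0 * L) = a k := haper.nat_mul k0 k
      have e2 : v (k + k0 * L + 1) = v (k+1) := by
        rw [add_right_comm]; exact hper.nat_mul k0 (k+1)
      rwa [e1, e2] at this
    have key : ∀ i, v (i * (L-1)) = v (i * (L-1) + (L-1) + 1) := by
      intro i
      rw [add_assoc, Nat.sub_add_cancel hL]
      exact (hper _).symm
    refine Path.false (d := d) (F := F) (L := L) (a := fun i => a (i * (L-1) + (L-1)))
      (v := fun i => v (i * (L-1))) ⟨hL, hF, h2F, h3F, fun _ => haF _, fun k => (hB _).1,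
      fun k => (hB _).2, ?_, ?_, ?_⟩
    · intro i
      show v ((i+1) * (L-1)) = mate d _ (v (i * (L-1)))
      rw [key i, hv, mate_mate, Nat.succ_mul]
    · intro i
      show Upper d _ (v (i * (L-1)))
      rw [key i]; exact hb' _
    · intro i
      show v ((i+L) * (L-1)) = v (i * (L-1))
      rw [add_mul, mul_comm L]; exact hper.nat_mul (L-1) _

lemma Wd_fin (n : ℕ) : ∀ l : List Z, l.length = n → l ≠ [] → l.IsChain (· ≠ ·) →
    {v | Wd d l v = v}.Finite := by
  induction n using Nat.strong_induction_on with
  | _ n ih =>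
  intro l hn hne hc
  rcases l with _ | ⟨f, t⟩
  · exact absurd rfl hne
  rcases List.eq_nil_or_concat t with rfl | ⟨t', g, rfl⟩
  · convert Set.finite_empty
    ext v
    simp [Wd, mate_ne]
  rw [List.concat_eq_append] at *
  by_cases hfg : f = g
  · subst hfg
    have ht' : t' ≠ [] := by rintro rfl; simp at hc
    have hc' : t'.IsChain (· ≠ ·) := by
      have := hc.tail; simp only [List.tail_cons] at this
      exact this.left_of_append
    have := ih t'.length (by simp at hn; omega) t' rfl ht' hc'
    apply (this.image (mate d f)).subset
    intro v hv
    refine ⟨mate d f v, ?_, mate_mate d f v⟩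
    have hv : mate d f (Wd d t' (mate d f v)) = v := by
      simpa [Wd] using hv
    show Wd d t' _ = _
    conv_rhs => rw [← hv]
    rw [mate_mate]
  · apply cyc_fin d _ hne
    intro i
    have hL : 0 < (f :: (t' ++ [g])).length := by simp
    set l := f :: (t' ++ [g]) with hl
    have hi := Nat.mod_lt i hL
    rw [← Nat.mod_add_mod]
    generalize i % l.length = k at hi
    by_cases h1 : k + 1 = l.length
    · rw [h1, Nat.mod_self]
      have : k = t'.length + 1 := by simp [hl] at h1; omega
      subst this
      simp [hl]; exact fun h => hfg h.symm
    · rw [Nat.mod_eq_of_lt (by omega)]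
      rw [List.getElem?_eq_getElem hi, List.getElem?_eq_getElem (by omega)]
      have := List.isChain_iff_getElem.1 hc k (by omega)
      simpa using this

lemma GG_word {g} (hg : g ∈ GG d) : ∃ l : List Z, l.IsChain (· ≠ ·) ∧ g = Wd d l := by
  induction hg using Subgroup.closure_induction_left with
  | one => exact ⟨[], by simp, rfl⟩
  | mul_left x hx y hy ih =>
    obtain ⟨f, rfl⟩ := hx
    obtain ⟨l, hl, rfl⟩ := ih
    rcases l with _ | ⟨h, t⟩
    · exact ⟨[f], by simp, by simp [Wd]⟩
    · by_cases hf : f = h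
      · subst hf
        exact ⟨t, hl.tail, by simp [Wd, ← mul_assoc, mateP_sq]⟩
      · exact ⟨f :: h :: t, by simp [hf, hl], by simp [Wd]⟩
  | inv_mul_cancel x hx y hy ih =>
    obtain ⟨f, rfl⟩ := hx
    have : (mateP d f)⁻¹ = mateP d f := inv_eq_of_mul_eq_one_left (mateP_sq d f)
    rw [this]
    obtain ⟨l, hl, rfl⟩ := ih
    rcases l with _ | ⟨h, t⟩
    · exact ⟨[f], by simp, by simp [Wd]⟩
    · by_cases hf : f = h
      · subst hf
        exact ⟨t, hl.tail, by simp [Wd, ← mul_assoc, mateP_sq]⟩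
      · exact ⟨f :: h :: t, by simp [hf, hl], by simp [Wd]⟩

lemma Wd_mem (l : List Z) : Wd d l ∈ GG d := by
  apply Subgroup.list_prod_mem
  simp only [List.mem_map]
  rintro _ ⟨f, _, rfl⟩
  exact Subgroup.subset_closure ⟨f, rfl⟩

theorem GG_cof {g} (hg : g ∈ GG d) (h1 : g ≠ 1) : {v | g v = v}.Finite := by
  obtain ⟨l, hl, rfl⟩ := GG_word d hg
  exact Wd_fin d _ l rfl (by rintro rfl; exact h1 rfl) hl

end MCG

namespace MCG
open Filter
variable (d : Z → Z)

def Linked (M : Set ℕ) (u v : ℕ → V) : Prop := ∃ 𝒢 : Set (Equiv.Perm V), 𝒢.Finite ∧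
  (∀ g ∈ 𝒢, g ∈ GG d) ∧ ∀ m ∈ M, ∃ g ∈ 𝒢, g (u m) = v m

variable {d}
lemma Linked.of_eq {M : Set ℕ} {u v : ℕ → V} (h : ∀ m ∈ M, u m = v m) : Linked d M u v :=
  ⟨{1}, by simp, by simp [one_mem], fun m hm => ⟨1, rfl, h m hm⟩⟩

lemma Linked.symm {M : Set ℕ} {u v : ℕ → V} (h : Linked d M u v) : Linked d M v u := by
  obtain ⟨G, h1, h2, h3⟩ := h
  refine ⟨(·⁻¹) '' G, h1.image _, ?_, ?_⟩
  · rintro _ ⟨g, hg, rfl⟩; exact inv_mem (h2 g hg)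
  · intro m hm
    obtain ⟨g, hg, h⟩ := h3 m hm
    exact ⟨g⁻¹, ⟨g, hg, rfl⟩, by rw [← h]; simp⟩

lemma Linked.trans {M : Set ℕ} {u v w : ℕ → V} (h : Linked d M u v) (h' : Linked d M v w) :
    Linked d M u w := by
  obtain ⟨G, h1, h2, h3⟩ := h
  obtain ⟨G', h1', h2', h3'⟩ := h'
  refine ⟨Set.image2 (fun a b => b * a) G G', h1.image2 _ h1', ?_, ?_⟩
  · rintro _ ⟨g, hg, g', hg', rfl⟩; exact mul_mem (h2' _ hg') (h2 g hg)
  · intro m hm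
    obtain ⟨g, hg, h⟩ := h3 m hm
    obtain ⟨g', hg', h'⟩ := h3' m hm
    exact ⟨_, ⟨g, hg, g', hg', rfl⟩, by simp [h, h']⟩

variable (d)
lemma linked_words {M : Set ℕ} {u v : ℕ → V} (S : Set (List Z)) (hS : S.Finite)
    (h : ∀ m ∈ M, ∃ l ∈ S, Wd d l (u m) = v m) : Linked d M u v := by
  refine ⟨Wd d '' S, hS.image _, ?_, ?_⟩
  · rintro _ ⟨l, _, rfl⟩; exact Wd_mem d l
  · intro m hm
    obtain ⟨l, hl, h⟩ := h m hm
    exact ⟨_, ⟨l, hl, rfl⟩, h⟩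

lemma mate_cst_r (f m k) : mate d (cst (2 + k % 2)) (r d f m (k+1)) = r d f m k := by
  rw [mate_cst]; exact sig_up d (r_not_dn_cst d f m k)

lemma linked_up {M : Set ℕ} (h : Z) (u : ℕ → V) (hu : ∀ m ∈ M, ¬ dn d h (u m)) :
    Linked d M (fun m => up d h (u m)) u := by
  apply linked_words d {[h], [h, cst 2, h], [cst 2, cst 3, h], [cst 3, cst 2, h]} (by simp)
  intro m hm
  have hd : dn d h (up d h (u m)) := (dn_up d _ _).2 (hu m hm)
  rcases dn_mate d hd with h1 | ⟨n, k, hD, h1, h2⟩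
  · exact ⟨[h], by simp, by simp [Wd, h1]; rfl⟩
  · cases k with
    | zero =>
      refine ⟨[h, cst 2, h], by simp, ?_⟩
      have e : u m = T d h n := (up_inj d h1).1
      have e2 : mate d (cst 2) (r d h n 1) = r d h n 0 := mate_cst_r d h n 0
      simp only [Wd, List.map_cons, List.map_nil, List.prod_cons, List.prod_nil, mul_one,
          Equiv.Perm.mul_apply, mateP_apply, h2]
      rw [zero_add, e2, mate_r d hD, e]; rfl
    | succ k =>
      have e : u m = r d h n k := (up_inj d h1).1
      have e2 := mate_cst_r d h n k
      have e3 := mate_cst_r d h n (k+1)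
      rcases Nat.mod_two_eq_zero_or_one k with hk | hk
      · have hk' : (k+1) % 2 = 1 := by omega
        rw [hk'] at e3; rw [hk] at e2
        refine ⟨[cst 2, cst 3, h], by simp, ?_⟩
        simp only [Wd, List.map_cons, List.map_nil, List.prod_cons, List.prod_nil, mul_one,
          Equiv.Perm.mul_apply, mateP_apply, h2]
        rw [e3, e2, e]
      · have hk' : (k+1) % 2 = 0 := by omega
        rw [hk'] at e3; rw [hk] at e2
        refine ⟨[cst 3, cst 2, h], by simp, ?_⟩
        simp only [Wd, List.map_cons, List.map_nil, List.prod_cons, List.prod_nil, mul_one,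
          Equiv.Perm.mul_apply, mateP_apply, h2]
        rw [e3, e2, e]

lemma linked_chain {M : Set ℕ} (W : List Z) : ∀ (v u : ℕ → V), (∀ m ∈ M, Chain d W (v m) (u m)) →
    Linked d M v u := by
  induction W with
  | nil => intro v u h; exact Linked.of_eq fun m hm => by have := (h m hm).eq; exact this
  | cons h W ih =>
    intro v u hc
    have : ∀ m ∈ M, ∃ v', v m = up d h v' ∧ ¬ dn d h v' ∧ Chain d W v' (u m) := by
      intro m hm
      have := hc m hm
      generalize v m = x at this
      cases this with
      | cons _ h1 h2 => exact ⟨_, rfl, h2, h1⟩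
    choose! v' h1 h2 h3 using this
    exact ((Linked.of_eq h1).trans (linked_up d h v' h2)).trans (ih v' u h3)

lemma linked_D {M : Set ℕ} (f : Z) (n : ℕ → ℕ) (h : ∀ m ∈ M, D f (n m)) :
    Linked d M (fun m => val f (n m)) (fun m => R f (n m)) := by
  apply linked_words d {[f, cst 0], [f, cst 1]} (by simp)
  intro m hm
  have h1 : mate d (cst (tau d f (n m))) (val f (n m)) = y d f (n m) 0 := by
    rw [mate_cst, sig_ndn d (tau_not_dn d f (n m))]; rfl
  refine ⟨[f, cst (tau d f (n m))], ?_, ?_⟩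
  · have := tau_le d f (n m)
    interval_cases h : tau d f (n m) <;> simp
  · simp only [Wd, List.map_cons, List.map_nil, List.prod_cons, List.prod_nil, mul_one,
          Equiv.Perm.mul_apply, mateP_apply]
    rw [h1, mate_y d (h m hm)]; rfl

lemma Phi_fst (i : ℕ) (x : Z × ℕ) : (Phi^[i] x).1 = phi^[i] x.1 := by
  induction i with
  | zero => rfl
  | succ i ih => rw [Function.iterate_succ_apply', Function.iterate_succ_apply', ← ih]; rfl

lemma Rem_tie {f m} (h : Rem f m) (i : ℕ) (h' : Rem (Phi^[i] (f, m)).1 (Phi^[i] (f, m)).2) :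
    R f m = R (Phi^[i] (f, m)).1 (Phi^[i] (f, m)).2 := by
  apply cd.injective
  apply le_antisymm
  · exact (h.2 i).2
  · obtain ⟨⟨l, hl, hp⟩, _⟩ := h
    have h2 := (h'.2 (i * l - i)).2
    have : Phi^[i * l - i] (Phi^[i] (f, m)) = (f, m) := by
      rw [← Function.iterate_add_apply, Nat.sub_add_cancel (Nat.le_mul_of_pos_right i hl)]
      exact (Function.IsPeriodicPt.const_mul hp i)
    rw [Prod.mk.eta, this] at h2
    exact h2

theorem link_main {f : Z} (hf : Function.Injective f) :
    ∃ M : Set ℕ, M.Infinite ∧ Linked d M (val f) (R f) := by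
  by_cases hfin : {m | D f m}.Infinite
  · exact ⟨_, hfin, linked_D d f id fun m hm => hm⟩
  rw [Set.not_infinite] at hfin
  have h0 : {m | D0 f m}.Finite := hfin.subset fun m hm => Or.inl hm
  have h1 := D01_inf hf h0
  let A : Set ℕ := {m | D1 f m ∧ Rem f m}
  have hA : A.Infinite := by
    intro hA
    apply h1
    apply (hA.union hfin).subset
    intro m hm
    by_cases hr : Rem f m
    · exact Or.inl ⟨hm, hr⟩
    · exact Or.inr (Or.inr ⟨hm, hr⟩)
  set p := Function.minimalPeriod phi f with hp
  have hp0 : 0 < p := by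
    obtain ⟨m, _, ⟨l, hl, h⟩, _⟩ := hA.nonempty
    apply Function.minimalPeriod_pos_of_mem_periodicPts
    refine ⟨l, hl, ?_⟩
    have := congrArg Prod.fst h
    rwa [Phi_fst] at this
  have hpp : phi^[p] f = f := Function.iterate_minimalPeriod
  have hDi : ∀ m ∈ A, ∀ i, R f m ≠ R (phi^[i] f) (Phi^[i] (f, m)).2 →
      D (phi^[i] f) (Phi^[i] (f, m)).2 := by
    intro m hm i hne
    right
    have e : (Phi^[i] (f, m)).1 = phi^[i] f := Phi_fst i _
    rw [← e] at hne ⊢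
    exact ⟨(hm.2.2 i).1, fun h' => hne (Rem_tie hm.2 i h')⟩
  have hfin1 : {m | m ∈ A ∧ Phi^[p] (f, m) ≠ (f, m)}.Finite := by
    apply Set.Finite.of_finite_image (f := fun m => (Phi^[p] (f, m)).2)
    · apply hfin.subset
      rintro _ ⟨m, ⟨hm, hne⟩, rfl⟩
      have := hDi m hm p
      rw [hpp] at this
      apply this
      intro hR
      apply hne
      refine Prod.ext ?_ (R_inj hR).1.symm
      rw [Phi_fst, hpp]
    · rintro m ⟨hm, _⟩ n ⟨hn, _⟩ h
      have hmp : ∀ m ∈ A, (f, m) ∈ Function.periodicPts Phi := by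
        rintro m ⟨_, ⟨l, hl, h⟩, _⟩; exact ⟨l, hl, h⟩
      have inj := ((Function.bijOn_periodicPts Phi).iterate p).injOn
      have := inj (hmp m hm) (hmp n hn) (Prod.ext (by rw [Phi_fst, Phi_fst]) h)
      simpa using this
  have hfin2 : (⋃ i ∈ Set.Ioo 0 p, {m | R f m = R (phi^[i] f) (Phi^[i] (f, m)).2}).Finite := by
    apply (Set.finite_Ioo 0 p).biUnion
    intro i hi
    have hne : phi^[i] f ≠ f := by
      intro h
      exact Function.not_isPeriodicPt_of_pos_of_lt_minimalPeriod hi.1.ne' hi.2 h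
    obtain ⟨j, hj⟩ := Function.ne_iff.1 hne
    apply (Set.finite_Iic j).subset
    intro m hm
    by_contra hc
    exact hj ((R_inj hm).2 j (by simpa using hc)).symm
  let M := A \ ({m | m ∈ A ∧ Phi^[p] (f, m) ≠ (f, m)} ∪
    ⋃ i ∈ Set.Ioo 0 p, {m | R f m = R (phi^[i] f) (Phi^[i] (f, m)).2})
  refine ⟨M, hA.sdiff (hfin1.union hfin2), ?_⟩
  have hMA : ∀ m ∈ M, m ∈ A := fun m hm => hm.1
  have hMp : ∀ m ∈ M, Phi^[p] (f, m) = (f, m) := by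
    intro m hm
    by_contra h
    exact hm.2 (Or.inl ⟨hm.1, h⟩)
  have hMD : ∀ m ∈ M, ∀ i, 0 < i → i < p → D (phi^[i] f) (Phi^[i] (f, m)).2 := by
    intro m hm i h1 h2
    apply hDi m hm.1
    intro hR
    apply hm.2
    right
    simp only [Set.mem_iUnion]
    exact ⟨i, ⟨h1, h2⟩, hR⟩
  have step : ∀ i, Linked d M (fun m => val (phi^[i] f) (Phi^[i] (f, m)).2)
      (fun m => R (phi^[i+1] f) (Phi^[i+1] (f, m)).2) := by
    intro i
    have hD1 : ∀ m ∈ M, D1 (phi^[i] f) (Phi^[i] (f, m)).2 := by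
      intro m hm
      have := ((hMA m hm).2.2 i).1
      rwa [Phi_fst] at this
    have hl : ∀ m, (Phi^[i+1] (f, m)).2 = (lbl (phi^[i] f) (Phi^[i] (f, m)).2).length := by
      intro m
      rw [Function.iterate_succ_apply']
      simp only [Phi, Phi_fst]
    have hb : ∀ m ∈ M, (val (phi^[i] f) (Phi^[i] (f, m)).2).1 =
        .inr (pre (phi^[i+1] f) (Phi^[i+1] (f, m)).2) := by
      intro m hm
      rw [D1_lbl (hD1 m hm), hl, Function.iterate_succ_apply', ← phi_spec (hD1 m hm)]
    obtain ⟨W, hW⟩ := limit d (phi^[i+1] f) ((fun m => val (phi^[i] f) (Phi^[i] (f, m)).2) '' M)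
      (by rintro _ ⟨m, hm, rfl⟩ _ ⟨n, hn, rfl⟩; exact D1_coh (hD1 m hm) (hD1 n hn))
      (by rintro _ ⟨m, hm, rfl⟩; exact ⟨_, hb m hm⟩)
    apply linked_chain d W
    intro m hm
    obtain ⟨m', hc⟩ := hW _ ⟨m, hm, rfl⟩
    have h2 := hc.fst
    simp only at h2
    rw [hb m hm] at h2
    have h2 := (pre_inj (Sum.inr.inj h2)).1
    rw [h2]; exact hc
  have all : ∀ i, i < p → Linked d M (val f) (fun m => R (phi^[i+1] f) (Phi^[i+1] (f, m)).2) := by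
    intro i
    induction i with
    | zero => intro _; exact step 0
    | succ i ih =>
      intro hi
      refine ((ih (by omega)).trans ?_).trans (step (i+1))
      exact (linked_D d _ (fun m => (Phi^[i+1] (f, m)).2) fun m hm => hMD m hm _ (by omega) hi).symm
  refine (all (p-1) (by omega)).trans (Linked.of_eq fun m hm => ?_)
  rw [Nat.sub_add_cancel hp0, hpp, hMp m hm]

theorem catch_ (F : Equiv.Perm V) : ∃ g ∈ GG d, {v | g (F v) = v}.Infinite := by
  let f : Z := fun n => cd (F (cd.symm n))
  have hf : Function.Injective f := fun a b h => by simpa [f] using h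
  obtain ⟨M, hM, 𝒢, h1, h2, h3⟩ := link_main d hf
  have hval : ∀ m, val f m = F (R f m) := by intro m; simp [val, f]
  by_contra hcon
  push Not at hcon
  apply hM
  have : (⋃ g ∈ 𝒢, {m | g (F (R f m)) = R f m}).Finite := by
    apply h1.biUnion
    intro g hg
    have := hcon g (h2 g hg)
    exact this.preimage (fun a _ b _ h => (R_inj h).1)
  apply this.subset
  intro m hm
  obtain ⟨g, hg, h⟩ := h3 m hm
  rw [hval] at h
  simp only [Set.mem_iUnion]
  exact ⟨g, hg, h⟩

end MCG

namespace MCG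
open Filter Topology

def DM {α : Type*} (e : Z → α) : Prop := ∀ a, MeasurableSet {f | e f = a}

lemma DM.dep {α β : Type*} [Countable α] {E : α → Z → β} {e : Z → α} (hE : ∀ a, DM (E a)) (he : DM e) :
    DM (fun f => E (e f) f) := by
  intro b
  have : {f | E (e f) f = b} = ⋃ a, ({f | e f = a} ∩ {f | E a f = b}) := by
    ext f; simp
  rw [this]
  exact MeasurableSet.iUnion fun a => (he a).inter (hE a b)

lemma DM.const {α : Type*} (a : α) : DM (fun _ => a) := fun _ => MeasurableSet.const _

lemma DM.comp {α β : Type*} [Countable α] (h : α → β) {e : Z → α} (he : DM e) : DM (fun f => h (e f)) :=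
  DM.dep (E := fun a _ => h a) (fun _ => DM.const _) he

lemma DM.comp₂ {α β γ : Type*} [Countable α] [Countable β] (h : α → β → γ) {e : Z → α} {e' : Z → β}
    (he : DM e) (he' : DM e') : DM (fun f => h (e f) (e' f)) :=
  DM.dep (E := fun a f => h a (e' f)) (fun a => he'.comp (h a)) he

lemma DM.set {p : Z → Prop} (h : DM p) : MeasurableSet {f | p f} := by
  have := h True
  simpa using this

lemma DM.of_set {p : Z → Prop} (h : MeasurableSet {f | p f}) : DM p := by
  intro a
  by_cases ha : a
  · simpa [ha] using h
  · have : {f | p f = a} = {f | p f}ᶜ := by ext f; simp [ha]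
    rw [this]; exact h.compl

lemma DM.of_eq {α : Type*} {e : Z → α} (h : ∀ a, DM (fun f => e f = a)) : DM e := fun a => (h a).set

lemma DM.and {p q : Z → Prop} (hp : DM p) (hq : DM q) : DM (fun f => p f ∧ q f) := hp.comp₂ And hq
lemma DM.or {p q : Z → Prop} (hp : DM p) (hq : DM q) : DM (fun f => p f ∨ q f) := hp.comp₂ Or hq
lemma DM.iff {p q : Z → Prop} (hp : DM p) (hq : DM q) : DM (fun f => p f ↔ q f) := hp.comp₂ Iff hq
lemma DM.imp {p q : Z → Prop} (hp : DM p) (hq : DM q) : DM (fun f => p f → q f) :=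
  hp.comp₂ (fun a b => a → b) hq
lemma DM.not {p : Z → Prop} (hp : DM p) : DM (fun f => ¬ p f) := hp.comp Not

lemma DM.ex {ι : Type*} [Countable ι] {p : ι → Z → Prop} (h : ∀ i, DM (p i)) : DM (fun f => ∃ i, p i f) := by
  apply DM.of_set
  have : {f | ∃ i, p i f} = ⋃ i, {f | p i f} := by ext f; simp
  rw [this]; exact MeasurableSet.iUnion fun i => (h i).set

lemma DM.all {ι : Type*} [Countable ι] {p : ι → Z → Prop} (h : ∀ i, DM (p i)) : DM (fun f => ∀ i, p i f) := by
  have := (DM.ex fun i => (h i).not).not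
  simpa using this

lemma DM.eval (i : ℕ) : DM (fun f => f i) := fun a =>
  measurable_pi_apply (X := fun _ : ℕ => ℕ) i (MeasurableSet.of_discrete (s := {a}))

lemma DM.sInf {E : Z → Set ℕ} (h : ∀ n, DM (fun f => n ∈ E f)) : DM (fun f => sInf (E f)) := by
  apply DM.of_eq
  intro a
  have : (fun f => InfSet.sInf (E f) = a) = fun f => (a ∈ E f ∧ ∀ b, b < a → ¬ b ∈ E f) ∨ (a = 0 ∧ ∀ b, ¬ b ∈ E f) := by
    ext f
    constructor
    · rintro rfl
      rcases (E f).eq_empty_or_nonempty with h | h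
      · right; rw [h]; simp
      · left; exact ⟨Nat.sInf_mem h, fun b hb => Nat.notMem_of_lt_sInf hb⟩
    · rintro (⟨h1, h2⟩ | ⟨rfl, h⟩)
      · apply le_antisymm (Nat.sInf_le h1)
        by_contra hc
        exact h2 _ (not_le.1 hc) (Nat.sInf_mem ⟨a, h1⟩)
      · rw [Set.eq_empty_of_forall_notMem h]; simp
  rw [this]
  exact ((h a).and (DM.all fun b => (DM.const _).imp (h b).not)).or
    ((DM.const _).and (DM.all fun b => (h b).not))

lemma DM_pre (m : ℕ) : DM (fun f => pre f m) := by
  induction m with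
  | zero => exact DM.const _
  | succ m ih =>
    have : (fun f => pre f (m+1)) = fun f => pre f m ++ [f m] := by
      ext1 f; simp [pre, List.range_succ]
    rw [this]
    exact ih.comp₂ (fun s a => s ++ [a]) (DM.eval m)

lemma DM_R (m : ℕ) : DM (fun f => R f m) := (DM_pre m).comp (fun s => ((.inr s, []) : V))

lemma DM_val (m : ℕ) : DM (fun f => val f m) := by
  have : DM (fun f => f (cd (R f m))) := DM.dep (E := fun a f => f a) DM.eval ((DM_R m).comp cd)
  exact this.comp cd.symm

lemma DM_val' {e : Z → ℕ} (he : DM e) : DM (fun f => val f (e f)) := DM.dep (E := fun m f => val f m) DM_val he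

lemma DM_inf {E : Z → Set ℕ} (h : ∀ n, DM (fun f => n ∈ E f)) : DM (fun f => (E f).Infinite) := by
  have : (fun f => (E f).Infinite) = fun f => ∀ N, ∃ n, n ∈ E f ∧ N < n := by
    ext f
    rw [Set.infinite_iff_exists_gt]
  rw [this]
  exact DM.all fun N => DM.ex fun n => (h n).and (DM.const _)

lemma DM_SS (i : ℕ) : (∀ j, DM (fun f => j ∈ SS f i)) := by
  induction i with
  | zero => intro j; exact DM.const True
  | succ i ih =>
    intro j
    have hd : DM (fun f => dd f i) := DM.sInf ih
    have hlt : ∀ k, DM (fun f => dd f i < k) := fun k => hd.comp (· < k)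
    have hc : ∀ k, DM (fun f => ¬ conf (val f (dd f i)) (val f k)) := fun k =>
      ((DM_val' hd).comp₂ conf (DM_val k)).not
    have hi : DM (fun f => inf0 f i) := DM_inf fun k => (ih k).and ((hlt k).and (hc k))
    exact (ih j).and ((hlt j).and (hi.iff (hc j)))

lemma DM_dd (i : ℕ) : DM (fun f => dd f i) := DM.sInf (DM_SS i)
lemma DM_inf0 (i : ℕ) : DM (fun f => inf0 f i) := DM_inf fun k => (DM_SS i k).and
  (((DM_dd i).comp (· < k)).and (((DM_val' (DM_dd i)).comp₂ conf (DM_val k)).not))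

lemma DM_injective : DM (fun f : Z => Function.Injective f) := by
  apply DM.all; intro a; apply DM.all; intro b
  exact DM.imp ((DM.eval a).comp₂ Eq (DM.eval b)) (DM.const _)

lemma DM_D0 (m : ℕ) : DM (fun f => D0 f m) :=
  DM_injective.and (DM.ex fun i => ((DM_dd i).comp (· = m)).and (DM_inf0 i))

lemma DM_D1 (m : ℕ) : DM (fun f => D1 f m) :=
  DM_injective.and ((DM.ex fun i => ((DM_dd i).comp (· = m)).and (DM_inf0 i).not).and
    ((DM_val m).comp (fun v : V => ∃ s, v.1 = .inr s)))

lemma DM_lbl (m : ℕ) : DM (fun f => lbl f m) := (DM_val m).comp lblV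

lemma DM_phi (i : ℕ) : DM (fun f => phi f i) :=
  DM.sInf fun a => DM.ex fun m => (DM_D1 m).and ((DM_lbl m).comp (fun s => s[i]? = some a))

lemma meas_phi : Measurable phi :=
  measurable_pi_iff.2 fun i => measurable_to_countable' fun a => DM_phi i a

lemma meas_phi_it (i : ℕ) : Measurable (phi^[i]) := meas_phi.iterate i

lemma DM.mcomp {α : Type*} {e : Z → α} (he : DM e) {φ : Z → Z} (hφ : Measurable φ) : DM (fun f => e (φ f)) :=
  fun a => hφ (he a)

lemma DM_it (m i : ℕ) : DM (fun f => (Phi^[i] (f, m)).2) := by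
  induction i with
  | zero => exact DM.const m
  | succ i ih =>
    have : (fun f => (Phi^[i+1] (f, m)).2) = fun f => (lbl (phi^[i] f) (Phi^[i] (f, m)).2).length := by
      ext1 f
      rw [Function.iterate_succ_apply']
      simp only [Phi, Phi_fst]
    rw [this]
    exact DM.dep (E := fun n f => (lbl (phi^[i] f) n).length)
      (fun n => ((DM_lbl n).comp List.length).mcomp (meas_phi_it i)) ih

lemma DM_Rem (m : ℕ) : DM (fun f => Rem f m) := by
  have : (fun f => Rem f m) = fun f => (∃ l : ℕ, 0 < l ∧ (∀ k, phi^[l] f k = f k) ∧ (Phi^[l] (f, m)).2 = m) ∧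
      ∀ i, D1 (phi^[i] f) (Phi^[i] (f, m)).2 ∧ cd (R f m) ≤ cd (R (phi^[i] f) (Phi^[i] (f, m)).2) := by
    ext f
    simp only [Rem, key, Phi_fst, Prod.ext_iff, funext_iff]
  rw [this]
  refine DM.and (DM.ex fun l => (DM.const _).and (DM.and (DM.all fun k => ?_) ((DM_it m l).comp (· = m))))
    (DM.all fun i => DM.and ?_ ?_)
  · exact ((DM.eval k).mcomp (meas_phi_it l)).comp₂ Eq (DM.eval k)
  · exact DM.dep (E := fun n f => D1 (phi^[i] f) n) (fun n => (DM_D1 n).mcomp (meas_phi_it i)) (DM_it m i)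
  · refine DM.comp₂ (fun a b : V => cd a ≤ cd b) (DM_R m) ?_
    exact DM.dep (E := fun n f => R (phi^[i] f) n) (fun n => (DM_R n).mcomp (meas_phi_it i)) (DM_it m i)

lemma DM_D (m : ℕ) : DM (fun f => D f m) := (DM_D0 m).or ((DM_D1 m).and (DM_Rem m).not)

lemma DM_Q (v : V) : DM (fun f => ∃ m, D f m ∧ val f m = v) :=
  DM.ex fun m => (DM_D m).and ((DM_val m).comp (· = v))

/-! witnesses -/

def CG (δ : Z → Z) : Prop := ∀ (F : ℕ → Z) (f g : Z), Tendsto F atTop (𝓝 f) →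
  Tendsto (fun i => δ (F i)) atTop (𝓝 g) → δ f = g

lemma tdZ {F : ℕ → Z} {f : Z} : Tendsto F atTop (𝓝 f) ↔ ∀ k, ∀ᶠ i in atTop, F i k = f k := by
  rw [tendsto_pi_nhds]
  simp only [nhds_discrete, tendsto_pure]

def Good (A : Set Z) : Prop := ∃ δ : Z → Z, CG δ ∧ ∃ S : Set ℕ, ∀ f, f ∈ A ↔ δ f 0 ∈ S

lemma Good.eval (i : ℕ) (t : Set ℕ) : Good {f | f i ∈ t} := by
  refine ⟨fun f _ => f i, ?_, t, fun f => Iff.rfl⟩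
  intro F f g hF hg
  ext k
  rw [tdZ] at hF hg
  obtain ⟨n, h1, h2⟩ := ((hF i).and (hg k)).exists
  exact h1.symm.trans h2

def Spec (P : ℕ → Prop) (a : ℕ) : Prop := (a = 0 ∧ ∀ n, ¬ P n) ∨ ∃ n, a = n + 1 ∧ P n ∧ ∀ k < n, ¬ P k

lemma Spec_ex (P : ℕ → Prop) : ∃ a, Spec P a := by
  classical
  by_cases h : ∃ n, P n
  · exact ⟨Nat.find h + 1, Or.inr ⟨_, rfl, Nat.find_spec h, fun k hk => Nat.find_min h hk⟩⟩
  · exact ⟨0, Or.inl ⟨rfl, by simpa using h⟩⟩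

lemma Spec_uniq {P : ℕ → Prop} {a b} (ha : Spec P a) (hb : Spec P b) : a = b := by
  rcases ha with ⟨rfl, h⟩ | ⟨n, rfl, h1, h2⟩ <;> rcases hb with ⟨rfl, h'⟩ | ⟨n', rfl, h1', h2'⟩
  · rfl
  · exact absurd h1' (h _)
  · exact absurd h1 (h' _)
  · rcases lt_trichotomy n n' with h | h | h
    · exact absurd h1 (h2' _ h)
    · rw [h]
    · exact absurd h1' (h2 _ h)

lemma Good.union (A : ℕ → Set Z) (h : ∀ n, Good (A n)) : Good (⋃ n, A n) := by
  choose δ hδ S hS using h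
  choose a ha using fun f => Spec_ex (fun n => δ n f 0 ∈ S n)
  let ε : Z → Z := fun f k => match k with
    | 0 => a f
    | k + 1 => δ (Nat.unpair k).1 f (Nat.unpair k).2
  have hε : ∀ f n k, ε f (Nat.pair n k + 1) = δ n f k := by intro f n k; simp [ε]
  refine ⟨ε, ?_, {x | x ≠ 0}, ?_⟩
  · intro F f g hF hg
    have h1 : ∀ n, δ n f = fun k => g (Nat.pair n k + 1) := by
      intro n
      apply hδ n F f _ hF
      rw [tdZ] at hg ⊢
      intro k
      filter_upwards [hg (Nat.pair n k + 1)] with i hi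
      rw [← hi, hε]
    rw [tdZ] at hg
    have h3 : ∀ n k, ∀ᶠ i in atTop, δ n (F i) k = δ n f k := by
      intro n k
      filter_upwards [hg (Nat.pair n k + 1)] with i hi
      rw [h1 n]; simp only; rw [← hi, hε]
    ext k
    cases k with
    | succ k =>
      have := congrFun (h1 (Nat.unpair k).1) (Nat.unpair k).2
      simp only [Nat.pair_unpair] at this
      exact this
    | zero =>
      refine Spec_uniq (ha f) ?_
      have hg0 : ∀ᶠ i in atTop, Spec (fun n => δ n (F i) 0 ∈ S n) (g 0) := by
        filter_upwards [hg 0] with i hi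
        rw [← hi]; exact ha (F i)
      by_cases h0 : g 0 = 0
      · left
        refine ⟨h0, fun n hn => ?_⟩
        obtain ⟨i, h4, h5⟩ := (hg0.and (h3 n 0)).exists
        rcases h4 with ⟨_, h4⟩ | ⟨n', h4, _⟩
        · apply h4 n; rw [h5]; exact hn
        · omega
      · right
        obtain ⟨n, hn⟩ := Nat.exists_eq_succ_of_ne_zero h0
        have h6 : ∀ᶠ i in atTop, ∀ k ∈ Set.Iic n, δ k (F i) 0 = δ k f 0 :=
          (Set.finite_Iic n).eventually_all.2 fun k _ => h3 k 0
        obtain ⟨i, h4, h5⟩ := (hg0.and h6).exists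
        rcases h4 with ⟨h4, _⟩ | ⟨n', h4, h7, h8⟩
        · omega
        · have : n' = n := by omega
          subst this
          refine ⟨n', hn, ?_, ?_⟩
          · simp only; rw [← h5 n' (by simp)]; exact h7
          · intro k hk; simp only; rw [← h5 k (by simp; omega)]; exact h8 k hk
  · intro f
    simp only [Set.mem_iUnion, hS, Set.mem_ofPred_eq]
    show _ ↔ a f ≠ 0
    rcases ha f with ⟨h1, h2⟩ | ⟨n, h1, h2, _⟩
    · simp [h1]; simpa using h2
    · simp only [h1]; simp; exact ⟨n, h2⟩

abbrev gm : MeasurableSpace Z where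
  MeasurableSet' := Good
  measurableSet_empty := ⟨fun _ _ => 0, fun _ _ g _ hg => by
    ext k; rw [tdZ] at hg; obtain ⟨n, h⟩ := (hg k).exists; exact h, ∅, by simp⟩
  measurableSet_compl := by
    rintro A ⟨δ, h, S, hS⟩
    exact ⟨δ, h, Sᶜ, fun f => by simp [hS]⟩
  measurableSet_iUnion := Good.union

lemma good_of_meas {A : Set Z} (h : MeasurableSet A) : Good A := by
  have : (MeasurableSpace.pi : MeasurableSpace Z) ≤ gm := by
    apply iSup_le
    intro i
    rintro _ ⟨t, _, rfl⟩
    exact Good.eval i t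
  exact this _ h

lemma exists_d : ∃ d : Z → Z, CG d ∧ ∀ (F : ℕ → Z) (f : Z), Tendsto F atTop (𝓝 f) →
    Tendsto (fun i => d (F i)) atTop (𝓝 (d f)) →
    (∀ m, ∀ᶠ i in atTop, (D (F i) m ↔ D f m)) ∧
    (∀ v, ∀ᶠ i in atTop, ((∃ m, D (F i) m ∧ val (F i) m = v) ↔ (∃ m, D f m ∧ val f m = v))) := by
  let e := Denumerable.eqv (ℕ ⊕ V)
  let A : ℕ ⊕ V → Set Z := fun x => match x with
    | .inl m => {f | D f m}
    | .inr v => {f | ∃ m, D f m ∧ val f m = v}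
  have hA : ∀ n, Good (A n) := by
    intro n
    apply good_of_meas
    rcases n with m | v
    · exact (DM_D m).set
    · exact (DM_Q v).set
  choose δ hδ S hS using hA
  let d : Z → Z := fun f k => δ (e.symm (Nat.unpair k).1) f (Nat.unpair k).2
  have hd : ∀ f x k, d f (Nat.pair (e x) k) = δ x f k := by intro f x k; simp [d]
  have main : ∀ (F : ℕ → Z) (f : Z), Tendsto (fun i => d (F i)) atTop (𝓝 (d f)) →
      ∀ x, ∀ᶠ i in atTop, (F i ∈ A x ↔ f ∈ A x) := by
    intro F f hF x
    rw [tdZ] at hF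
    filter_upwards [hF (Nat.pair (e x) 0)] with i hi
    rw [hd, hd] at hi
    rw [hS, hS, hi]
  refine ⟨d, ?_, fun F f _ h => ⟨fun m => main F f h (.inl m), fun v => main F f h (.inr v)⟩⟩
  intro F f g hF hg
  have h1 : ∀ x, δ x f = fun k => g (Nat.pair (e x) k) := by
    intro x
    apply hδ x F f _ hF
    rw [tdZ] at hg ⊢
    intro k
    filter_upwards [hg (Nat.pair (e x) k)] with i hi
    rw [← hi, hd]
  ext k
  have := congrFun (h1 (e.symm (Nat.unpair k).1)) (Nat.unpair k).2
  simpa using this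

end MCG

namespace MCG
open Filter Topology
variable (d : Z → Z)

structure Cv (F : ℕ → Z) (f : Z) : Prop where
  h1 : ∀ k, ∀ᶠ i in atTop, F i k = f k
  h2 : ∀ k, ∀ᶠ i in atTop, d (F i) k = d f k
  h3 : ∀ m, ∀ᶠ i in atTop, (D (F i) m ↔ D f m)
  h4 : ∀ v, ∀ᶠ i in atTop, ((∃ m, D (F i) m ∧ val (F i) m = v) ↔ (∃ m, D f m ∧ val f m = v))

lemma ev_pre' {F : ℕ → Z} {f : Z} (h : ∀ k, ∀ᶠ i in atTop, F i k = f k) (m : ℕ) :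
    ∀ᶠ i in atTop, pre (F i) m = pre f m := by
  have : ∀ᶠ i in atTop, ∀ k ∈ Set.Iio m, F i k = f k :=
    (Set.finite_Iio m).eventually_all.2 fun k _ => h k
  filter_upwards [this] with i hi
  exact pre_eq_iff.2 hi

open Classical in
noncomputable def Tv (w : V) : V := up d (cst (if dn d (cst 0) w then 1 else 0)) w

lemma T_eq (f m) : T d f m = Tv d (val f m) := rfl

variable {d}
namespace Cv
variable {F : ℕ → Z} {f : Z} (H : Cv d F f)
include H

lemma sq' (b : B) (k : ℕ) : ∀ᶠ i in atTop, sq d (F i) b k = sq d f b k := by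
  cases b with
  | inl x => filter_upwards [H.h1 k, H.h2 k] with i h1 h2; simp [sq, h1, h2]
  | inr x => exact H.h1 k

lemma lab' (u : V) : ∀ᶠ i in atTop, lab d (F i) u = lab d f u := ev_pre' (H.sq' u.1) _

lemma up' (u : V) : ∀ᶠ i in atTop, up d (F i) u = up d f u := by
  filter_upwards [H.lab' u] with i hi
  simp [up, hi]

lemma dn' (u : V) : ∀ᶠ i in atTop, (dn d (F i) u ↔ dn d f u) := by
  filter_upwards [ev_pre' (H.sq' u.1) (mm u.1 u.2)] with i hi
  unfold dn
  rw [dnx_iff_dnl _ _ _ _ le_rfl, dnx_iff_dnl _ _ _ _ le_rfl, hi]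

lemma sig' (u : V) : ∀ᶠ i in atTop, sig d (F i) u = sig d f u := by
  filter_upwards [H.dn' u, H.up' u] with i h1 h2
  by_cases h : dn d f u
  · rw [sig_dn d h, sig_dn d (h1.2 h)]
  · rw [sig_ndn d h, sig_ndn d (fun h' => h (h1.1 h')), h2]

lemma r' (m k : ℕ) : ∀ᶠ i in atTop, r d (F i) m k = r d f m k := by
  filter_upwards [ev_pre' H.h1 m] with i hi
  induction k with
  | zero => simp [r, R, hi]
  | succ k ih => simp [r, ih]

lemma val' (m : ℕ) : ∀ᶠ i in atTop, val (F i) m = val f m := by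
  filter_upwards [ev_pre' H.h1 m, H.h1 (cd (R f m))] with i hi h2
  have : R (F i) m = R f m := by simp [R, hi]
  rw [val, this, h2]; rfl

lemma T' (m : ℕ) : ∀ᶠ i in atTop, T d (F i) m = T d f m := by
  filter_upwards [H.val' m] with i hi
  rw [T_eq, T_eq, hi]

lemma y' (m k : ℕ) : ∀ᶠ i in atTop, y d (F i) m k = y d f m k := by
  rcases k with _ | _ | k
  · exact H.T' m
  · filter_upwards [H.T' m, H.up' (T d f m)] with i h1 h2
    simp [y, h1, h2]
  · filter_upwards [H.r' m k, H.up' (r d f m k)] with i h1 h2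
    simp [y, h1, h2]

lemma hot' (v : V) : ∀ᶠ i in atTop, (Hot d (F i) v → Hot d f v) := by
  let m0 := (lblV v).length
  let n0 := v.2.length
  let w1 : V := (v.1, v.2.tail)
  let w2 : V := (v.1, v.2.tail.tail)
  filter_upwards [H.h3 m0, H.r' m0 n0, H.r' m0 (n0 - 1), H.h4 w1, H.h4 w2, H.up' w1] with
    i e1 e2 e3 e4 e5 e6
  rintro ⟨m, k, hD, hv | hv⟩
  · have hm : m0 = m := by simp only [m0]; rw [hv]; simp [lblV, r_fst]
    have hn : n0 = k := by simp only [n0]; rw [hv, r_len]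
    rw [hm, hn] at e2; rw [hm] at e1
    exact ⟨m, k, e1.1 hD, Or.inl (hv.trans e2)⟩
  · rcases k with _ | _ | k
    · have hw : w1 = val (F i) m := by simp only [w1]; rw [hv]; rfl
      obtain ⟨m', hD', hv'⟩ := e4.1 ⟨m, hD, hw.symm⟩
      refine ⟨m', 0, hD', Or.inr ?_⟩
      rw [hv]
      show T d _ _ = T d _ _
      rw [T_eq, T_eq, hv', hw]
    · have hw : w2 = val (F i) m := by simp only [w2]; rw [hv]; rfl
      have hw1 : w1 = T d (F i) m := by simp only [w1]; rw [hv]; rfl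
      obtain ⟨m', hD', hv'⟩ := e5.1 ⟨m, hD, hw.symm⟩
      refine ⟨m', 1, hD', Or.inr ?_⟩
      have hT : T d f m' = T d (F i) m := by rw [T_eq, T_eq, hv', hw]
      rw [hv]
      show up d _ (T d _ _) = up d _ (T d _ _)
      rw [hT, ← hw1, e6]
    · have hm : m0 = m := by simp only [m0]; rw [hv]; simp [lblV, y, up, r_fst]
      have hn : n0 = k + 1 := by
        simp only [n0]; rw [hv]; simp [y, up, r_len]
      have hw1 : w1 = r d (F i) m k := by simp only [w1]; rw [hv]; rfl
      rw [hm, hn, Nat.add_sub_cancel] at e3; rw [hm] at e1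
      refine ⟨m, k+2, e1.1 hD, Or.inr ?_⟩
      rw [hv]
      show up d _ _ = up d _ _
      rw [← e3, ← hw1, e6]

lemma mate' (v : V) : ∀ᶠ i in atTop, mate d (F i) v = mate d f v := by
  by_cases h : Hot d f v
  · obtain ⟨m, k, hD, hv | hv⟩ := h
    · filter_upwards [H.r' m k, H.y' m k, H.h3 m] with i h1 h2 h3
      rw [hv, mate_r d hD, ← h1, mate_r d (h3.2 hD), h2]
    · filter_upwards [H.r' m k, H.y' m k, H.h3 m] with i h1 h2 h3
      rw [hv, mate_y d hD, ← h2, mate_y d (h3.2 hD), h1]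
  · filter_upwards [H.hot' v, H.sig' v] with i h1 h2
    rw [mate_nHot d h, mate_nHot d (fun h' => h (h1 h')), h2]

end Cv

variable (d)
noncomputable def Wn (a : ℕ → Z) : ℕ → V → V
  | 0, v => v
  | n + 1, v => mate d (a n) (Wn a n v)

noncomputable def Upn (a : ℕ → Z) : ℕ → V → V
  | 0, v => v
  | n + 1, v => up d (a n) (Upn a n v)

lemma Upn_fst (a n v) : (Upn d a n v).1 = v.1 := by
  induction n with
  | zero => rfl
  | succ n ih => exact ih

lemma Wn_conv {L : ℕ} (F : ℕ → ℕ → Z) (a : ℕ → Z) (h : ∀ k < L, Cv d (fun i => F i k) (a k)) (v : V) :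
    ∀ n ≤ L, ∀ᶠ i in atTop, Wn d (F i) n v = Wn d a n v := by
  intro n
  induction n with
  | zero => intro _; exact Eventually.of_forall fun _ => rfl
  | succ n ih =>
    intro hn
    filter_upwards [ih (by omega), (h n (by omega)).mate' (Wn d a n v)] with i h1 h2
    simp only [Wn, h1, h2]

lemma Wn_Up {L N q p : ℕ} (hq : N ≤ q) (a : ℕ → Z)
    (hs : ∀ k, k + 1 < L → pre (a k) N ≠ pre (a (k+1)) N)
    (hu : ∀ k < L, ∀ m, D (a k) m → (val (a k) m).1 ≠ .inl (q, p)) :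
    ∀ n ≤ L, Wn d a n (.inl (q, p), []) = Upn d a n (.inl (q, p), []) := by
  intro n
  induction n with
  | zero => intro _; rfl
  | succ n ih =>
    intro hn
    simp only [Wn, Upn]
    rw [ih (by omega)]
    set w := Upn d a n (.inl (q, p), []) with hw
    have hb : w.1 = .inl (q, p) := Upn_fst d a n _
    rw [mate_nHot, sig_ndn]
    · cases n with
      | zero => exact dn_nil d _ _
      | succ n =>
        intro hd
        have h1 : w = up d (a n) (Upn d a n (.inl (q, p), [])) := rfl
        rw [h1] at hd
        apply hs n (by omega)
        rw [pre_eq_iff]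
        intro i hi
        refine (dn_up_of d hd i ?_).symm
        have := mm_ge_q (Upn d a n (.inl (q, p), [])).1 (Upn d a n (.inl (q, p), [])).2
        have h2 : qof (Upn d a n (.inl (q, p), [])).1 = q := by rw [Upn_fst]; rfl
        omega
    · rintro ⟨m, k, hD, hv | hv⟩
      · rw [hv, r_fst] at hb; cases hb
      · rcases k with _ | _ | k
        · rw [hv] at hb; exact hu n (by omega) m hD hb
        · rw [hv] at hb; exact hu n (by omega) m hD hb
        · rw [hv] at hb
          have : (r d (a n) m k).1 = .inl (q, p) := hb
          rw [r_fst] at this; cases this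

lemma unhit {L q : ℕ} (hq : L ≤ q) (a : ℕ → Z) :
    ∃ p ≤ L, ∀ k < L, ∀ m, D (a k) m → (val (a k) m).1 ≠ .inl (q, p) := by
  by_contra hcon
  push Not at hcon
  choose! k hk m hD hv using hcon
  obtain ⟨p, hp, p', hp', hne, he⟩ := Finset.exists_ne_map_eq_of_card_lt_of_maps_to
    (s := Finset.range (L+1)) (t := Finset.range L) (f := k) (by simp) (by
      intro p hp
      simp only [Finset.coe_range, Set.mem_Iio] at hp ⊢
      exact hk p (by omega))
  simp only [Finset.mem_range] at hp hp'
  have h1 := hD p (by omega)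
  have h2 := hD p' (by omega)
  have h3 := hv p (by omega)
  have h4 := hv p' (by omega)
  rw [← he] at h2 h4
  exact hne (D_hit h1 h2 h3 h4 (by omega) (by omega))

lemma Upn_mem (a : ℕ → Z) (v : V) (k n : ℕ) (h : k < n) :
    lab d (a k) (Upn d a k v) ∈ (Upn d a n v).2 := by
  induction n, h using Nat.le_induction with
  | base => simp [Upn, up]
  | succ n _ ih => simp only [Upn, up]; exact List.mem_cons_of_mem _ ih

def SL (L N : ℕ) : Set (ℕ → ℕ) := {h | ∃ a : ℕ → Z,
  (∀ k, k + 1 < L → pre (a k) N ≠ pre (a (k+1)) N) ∧ ∀ n, h n = cd (Wn d a L (cd.symm n))}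

lemma bound {L N : ℕ} (hh : ℕ → ℕ → ℕ) (h : ℕ → ℕ) (hlim : ∀ n, ∀ᶠ i in atTop, hh i n = h n)
    (a : ℕ → ℕ → Z) (hs : ∀ i k, k + 1 < L → pre (a i k) N ≠ pre (a i (k+1)) N)
    (ha : ∀ i n, hh i n = cd (Wn d (a i) L (cd.symm n))) (j : ℕ) :
    ∃ C, ∀ᶠ i in atTop, ∀ k < L, Nat.pair (a i k j) (d (a i k) j) ≤ C := by
  let q := L + N + j + 1
  let z : ℕ → V := fun p => (.inl (q, p), [])
  let S : Set ℕ := ⋃ p ∈ Set.Iic L, {x | x ∈ (cd.symm (h (cd (z p)))).2.flatten}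
  have hS : S.Finite := (Set.finite_Iic L).biUnion fun p _ => List.finite_toSet _
  obtain ⟨C, hC⟩ := hS.bddAbove
  refine ⟨C, ?_⟩
  have hev : ∀ᶠ i in atTop, ∀ p ∈ Set.Iic L, hh i (cd (z p)) = h (cd (z p)) :=
    (Set.finite_Iic L).eventually_all.2 fun p _ => hlim _
  filter_upwards [hev] with i hi k hk
  obtain ⟨p, hp, hu⟩ := unhit (L := L) (q := q) (by omega) (a i)
  have h1 := Wn_Up d (N := N) (q := q) (by omega) (a i) (hs i) hu L le_rfl
  have h2 := hi p hp
  rw [ha, Equiv.symm_apply_apply, h1] at h2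
  have h3 := Upn_mem d (a i) (z p) k L hk
  have h4 : Upn d (a i) L (z p) = cd.symm (h (cd (z p))) := by rw [← h2, Equiv.symm_apply_apply]
  rw [h4] at h3
  apply hC
  simp only [S, Set.mem_iUnion]
  refine ⟨p, hp, ?_⟩
  refine List.mem_flatten.2 ⟨_, h3, ?_⟩
  simp only [lab, pre]
  refine List.mem_map.2 ⟨j, ?_, ?_⟩
  · have := mm_ge_q (Upn d (a i) k (z p)).1 (Upn d (a i) k (z p)).2
    have h2 : qof (Upn d (a i) k (z p)).1 = q := by rw [Upn_fst]; rfl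
    simp only [List.mem_range]; omega
  · rw [Upn_fst]; rfl

lemma SL_closed (hCG : CG d) (hd : ∀ (F : ℕ → Z) (f : Z), Tendsto F atTop (𝓝 f) →
    Tendsto (fun i => d (F i)) atTop (𝓝 (d f)) →
    (∀ m, ∀ᶠ i in atTop, (D (F i) m ↔ D f m)) ∧
    (∀ v, ∀ᶠ i in atTop, ((∃ m, D (F i) m ∧ val (F i) m = v) ↔ (∃ m, D f m ∧ val f m = v))))
    (L N : ℕ) : IsClosed (SL d L N) := by
  apply IsSeqClosed.isClosed
  intro hh h hmem hlim
  choose a hs ha using hmem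
  rw [tdZ] at hlim
  have hb := bound d hh h hlim a hs ha
  let X : ℕ → ℕ → ℕ → ℕ := fun i k j => if k < L then Nat.pair (a i k j) (d (a i k) j) else 0
  have hX : ∀ k j, ∃ C, ∀ i, X i k j ≤ C := by
    intro k j
    obtain ⟨C, hC⟩ := hb j
    obtain ⟨I, hI⟩ := eventually_atTop.1 hC
    obtain ⟨C', hC'⟩ := ((Set.finite_Iio I).image (fun i => X i k j)).bddAbove
    refine ⟨max C C', fun i => ?_⟩
    rcases Nat.lt_or_ge i I with hi | hi
    · exact le_max_of_le_right (hC' ⟨i, hi, rfl⟩)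
    · apply le_max_of_le_left
      simp only [X]
      split_ifs with hk
      · exact hI i hi k hk
      · exact Nat.zero_le _
  choose C hC using hX
  have hcomp : IsCompact (Set.pi Set.univ fun k => Set.pi Set.univ fun j => Set.Iic (C k j) : Set (ℕ → ℕ → ℕ)) :=
    isCompact_univ_pi fun k => isCompact_univ_pi fun j => (Set.finite_Iic _).isCompact
  obtain ⟨Y, _, φ, hφ, hY⟩ := hcomp.tendsto_subseq (x := X) (fun i k _ j _ => hC k j i)
  have hY' : ∀ k j, ∀ᶠ i in atTop, X (φ i) k j = Y k j := by
    intro k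
    exact tdZ.1 (tendsto_pi_nhds.1 hY k)
  let f : ℕ → Z := fun k j => (Nat.unpair (Y k j)).1
  have hf1 : ∀ k < L, ∀ j, ∀ᶠ i in atTop, a (φ i) k j = f k j := by
    intro k hk j
    filter_upwards [hY' k j] with i hi
    simp only [X, hk, if_true] at hi
    simp [f, ← hi]
  have hf2 : ∀ k < L, d (f k) = fun j => (Nat.unpair (Y k j)).2 := by
    intro k hk
    apply hCG (fun i => a (φ i) k)
    · exact tdZ.2 (hf1 k hk)
    · rw [tdZ]
      intro j
      filter_upwards [hY' k j] with i hi
      simp only [X, hk, if_true] at hi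
      simp [← hi]
  have hf3 : ∀ k < L, ∀ j, ∀ᶠ i in atTop, d (a (φ i) k) j = d (f k) j := by
    intro k hk j
    rw [hf2 k hk]
    filter_upwards [hY' k j] with i hi
    simp only [X, hk, if_true] at hi
    simp [← hi]
  have hCv : ∀ k < L, Cv d (fun i => a (φ i) k) (f k) := by
    intro k hk
    have := hd (fun i => a (φ i) k) (f k) (tdZ.2 (hf1 k hk)) (tdZ.2 (hf3 k hk))
    exact ⟨hf1 k hk, hf3 k hk, this.1, this.2⟩
  refine ⟨f, ?_, ?_⟩
  · intro k hk he
    obtain ⟨i, h1, h2⟩ := ((ev_pre' (hf1 k (by omega)) N).and (ev_pre' (hf1 (k+1) hk) N)).exists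
    apply hs (φ i) k hk
    rw [h1, h2, he]
  · intro n
    obtain ⟨i, h1, h2⟩ := ((Wn_conv d (fun i => a (φ i)) f hCv (cd.symm n) L le_rfl).and
      (hφ.tendsto_atTop.eventually (hlim n))).exists
    rw [← h2, ha, h1]

lemma Wn_mem (a : ℕ → Z) (n : ℕ) : ∃ g ∈ GG d, ∀ v, g v = Wn d a n v := by
  induction n with
  | zero => exact ⟨1, one_mem _, fun v => rfl⟩
  | succ n ih =>
    obtain ⟨g, hg, h⟩ := ih
    exact ⟨mateP d (a n) * g, mul_mem (Subgroup.subset_closure ⟨_, rfl⟩) hg, fun v => by simp [Wn, h]⟩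

lemma mem_Wn {g} (hg : g ∈ GG d) : ∃ L N, ∃ a : ℕ → Z,
    (∀ k, k + 1 < L → pre (a k) N ≠ pre (a (k+1)) N) ∧ ∀ v, g v = Wn d a L v := by
  obtain ⟨l, hl, rfl⟩ := GG_word d hg
  let a : ℕ → Z := fun k => l.getD (l.length - 1 - k) (cst 0)
  have hne : ∀ k, k + 1 < l.length → ∃ n, a k n ≠ a (k+1) n := by
    intro k hk
    apply Function.ne_iff.1
    have := List.isChain_iff_getElem.1 hl (l.length - 1 - (k+1)) (by omega)
    simp only [a]
    rw [List.getD_eq_getElem _ _ (by omega), List.getD_eq_getElem _ _ (by omega)]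
    intro h
    apply this
    rw [← h]
    congr 1; omega
  choose! n hn using hne
  refine ⟨l.length, (Finset.range l.length).sup n + 1, a, ?_, ?_⟩
  · intro k hk he
    refine hn k hk (pre_eq_iff.1 he (n k) ?_)
    exact Nat.lt_succ_of_le (Finset.le_sup (f := n) (by simp; omega))
  · intro v
    have : ∀ k ≤ l.length, Wn d a k v = Wd d (l.drop (l.length - k)) v := by
      intro k
      induction k with
      | zero => intro _; simp [Wn, Wd]
      | succ k ih =>
        intro hk
        simp only [Wn]
        rw [ih (by omega), List.drop_eq_getElem_cons (i := l.length - (k+1)) (by omega)]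
        have e : l.length - (k+1) + 1 = l.length - k := by omega
        have e2 : a k = l[l.length - (k+1)] := by
          simp only [a]
          rw [List.getD_eq_getElem _ _ (by omega)]
          congr 1; omega
        rw [e, e2]; rfl
    rw [this _ le_rfl]; simp

end MCG


theorem exists_Fsigma_mcg :
    ∃ G : Subgroup (Equiv.Perm ℕ),
      IsMaximalCofinitary G ∧
      IsFsigma ((fun g : Equiv.Perm ℕ => (g : ℕ → ℕ)) '' (G : Set (Equiv.Perm ℕ))) := by
  obtain ⟨d, hCG, hd⟩ := MCG.exists_d
  let Φ : Equiv.Perm MCG.V ≃* Equiv.Perm ℕ := MCG.cd.permCongrHom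
  have hΦ : ∀ g n, Φ g n = MCG.cd (g (MCG.cd.symm n)) := fun g n => rfl
  have hcof : IsCofinitary ((MCG.GG d).map Φ.toMonoidHom) := by
    rintro _ ⟨g, hg, rfl⟩ hne
    have hg1 : g ≠ 1 := by rintro rfl; exact hne (map_one _)
    apply ((MCG.GG_cof d hg hg1).image MCG.cd).subset
    intro n hn
    have hn : MCG.cd (g (MCG.cd.symm n)) = n := hn
    refine ⟨MCG.cd.symm n, ?_, by simp⟩
    show g _ = _
    rw [Equiv.eq_symm_apply]; exact hn
  refine ⟨(MCG.GG d).map Φ.toMonoidHom, ⟨hcof, ?_⟩, ?_⟩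
  · intro H hH hle
    apply le_antisymm hle
    intro f hf
    obtain ⟨g, hg, hinf⟩ := MCG.catch_ d (Φ.symm f)
    have hgm : Φ g ∈ (MCG.GG d).map Φ.toMonoidHom := ⟨g, hg, rfl⟩
    have h1 : Φ g * f = 1 := by
      by_contra hne
      have hfin := hH _ (mul_mem (hle hgm) hf) hne
      apply hinf
      apply (hfin.preimage MCG.cd.injective.injOn).subset
      intro v hv
      have hv : g ((Φ.symm f) v) = v := hv
      show (Φ g * f) (MCG.cd v) = MCG.cd v
      have e : f = Φ (Φ.symm f) := by simp
      rw [e, ← map_mul, hΦ]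
      simp [hv]
    have h2 : f = (Φ g)⁻¹ := (inv_eq_of_mul_eq_one_right h1).symm
    rw [h2]; exact inv_mem hgm
  · refine ⟨fun n => MCG.SL d (Nat.unpair n).1 (Nat.unpair n).2,
      fun n => MCG.SL_closed d hCG hd _ _, ?_⟩
    ext h
    simp only [Set.mem_iUnion]
    constructor
    · rintro ⟨_, ⟨g, hg, rfl⟩, rfl⟩
      obtain ⟨L, N, a, h1, h2⟩ := MCG.mem_Wn d hg
      refine ⟨Nat.pair L N, ?_⟩
      rw [Nat.unpair_pair]
      refine ⟨a, h1, fun n => ?_⟩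
      rw [← h2]; rfl
    · rintro ⟨n, a, _, h2⟩
      obtain ⟨g, hg, h⟩ := MCG.Wn_mem d a (Nat.unpair n).1
      refine ⟨Φ g, ⟨g, hg, rfl⟩, ?_⟩
      ext k
      rw [h2, ← h]; rfl
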